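/- arXiv:1606.08533 — 2 statements merged into one kernel-verified Lean document; each statement's English description precedes it below -/
import Mathlib

section
/- Let k ≥ 0, r = k + 1, and 0 ≤ s ≤ k. Suppose a_2 is (s+1)-times continuously differentiable with a_2(x) ≥ a_min > 0 on [a,b] and a_0 is continuous with a_0 ≥ 0. There exists a constant C > 0, independent of the partition, such that for every partition a = x_1 < … < x_N = b, if u is (s+2)-times continuously differentiable on [a,b], solves −(a_2 u′)′ + a_0 u = f on (a,b) with u(a) = 0, u′(b) = 0, and u_h ∈ S_h is the weak finite element solution, then ‖d_{w,r}u_h − u′‖_h ≤ C h^{s+1} ‖u‖_{s+2}, where h is the mesh size. -/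
open MeasureTheory Set

noncomputable section

/-- `p` is the discrete weak derivative of order `r` of the weak function
`(v0, vl, vr)` on the interval `(c, d)`: it is a polynomial of degree at most `r`
satisfying `∫ p q = -∫ v0 q' + vr q(d) - vl q(c)` for all polynomials `q` of
degree at most `r`. -/
def IsWeakDeriv (r : ℕ) (c d : ℝ) (v0 : ℝ → ℝ) (vl vr : ℝ) (p : Polynomial ℝ) : Prop :=
  p.degree ≤ (r : WithBot ℕ) ∧ ∀ q : Polynomial ℝ, q.degree ≤ (r : WithBot ℕ) →
    (∫ t in c..d, p.eval t * q.eval t) =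
      -(∫ t in c..d, v0 t * q.derivative.eval t) + vr * q.eval d - vl * q.eval c

/-- `p` is the L²(c,d)-orthogonal projection of `g` onto polynomials of degree at most `l`. -/
def IsL2Proj (l : ℕ) (c d : ℝ) (g : ℝ → ℝ) (p : Polynomial ℝ) : Prop :=
  p.degree ≤ (l : WithBot ℕ) ∧ ∀ q : Polynomial ℝ, q.degree ≤ (l : WithBot ℕ) →
    (∫ t in c..d, (g t - p.eval t) * q.eval t) = 0

/-- `x 0 = a < x 1 < ⋯ < x (N-1) = b` is a partition of `(a,b)`. -/
def IsPartition (N : ℕ) (a b : ℝ) (x : ℕ → ℝ) : Prop :=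
  2 ≤ N ∧ x 0 = a ∧ x (N - 1) = b ∧ ∀ i < N - 1, x i < x (i + 1)

/-- Membership in the weak finite element space `S_h`: on each of the `N - 1` elements the
interior component is a polynomial of degree at most `k`, the nodal values are single
valued, and the nodal value at the left endpoint vanishes. -/
def MemSh (k N : ℕ) (v0 : ℕ → Polynomial ℝ) (vn : ℕ → ℝ) : Prop :=
  (∀ i < N - 1, (v0 i).degree ≤ (k : WithBot ℕ)) ∧ vn 0 = 0

/-- `D i` is the discrete weak derivative of order `r` of the weak finite element function
`(v0, vn)` on the `i`-th element `(x i, x (i+1))`. -/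
def IsWeakDerivFam (r N : ℕ) (x : ℕ → ℝ) (v0 : ℕ → Polynomial ℝ) (vn : ℕ → ℝ)
    (D : ℕ → Polynomial ℝ) : Prop :=
  ∀ i < N - 1, IsWeakDeriv r (x i) (x (i + 1)) (fun t => (v0 i).eval t) (vn i) (vn (i + 1)) (D i)

/-- `(u0, un)` with discrete weak derivatives `Du` is a weak finite element solution:
it belongs to `S_h` and satisfies
`(a2 d_w u_h, d_w v)_h + (a0 u_h⁰, v⁰) = (f, v⁰)` for all `v ∈ S_h`. -/
def IsWFESol (k r N : ℕ) (x : ℕ → ℝ) (a2 a0 f : ℝ → ℝ)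
    (u0 : ℕ → Polynomial ℝ) (un : ℕ → ℝ) (Du : ℕ → Polynomial ℝ) : Prop :=
  MemSh k N u0 un ∧ IsWeakDerivFam r N x u0 un Du ∧
  ∀ (v0 : ℕ → Polynomial ℝ) (vn : ℕ → ℝ) (Dv : ℕ → Polynomial ℝ),
    MemSh k N v0 vn → IsWeakDerivFam r N x v0 vn Dv →
    ((∑ i ∈ Finset.range (N - 1), ∫ t in x i..x (i + 1), a2 t * (Du i).eval t * (Dv i).eval t)
      + ∑ i ∈ Finset.range (N - 1), ∫ t in x i..x (i + 1), a0 t * (u0 i).eval t * (v0 i).eval t)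
      = ∑ i ∈ Finset.range (N - 1), ∫ t in x i..x (i + 1), f t * (v0 i).eval t

/-- The Sobolev norm `‖u‖_m = (∑_{j=0}^m ∫_a^b |u^{(j)}|² dx)^{1/2}` of an `m`-times
continuously differentiable function on `[a,b]`. -/
def sobNorm (m : ℕ) (a b : ℝ) (u : ℝ → ℝ) : ℝ :=
  Real.sqrt (∑ j ∈ Finset.range (m + 1),
    ∫ t in a..b, (iteratedDerivWithin j u (Set.Icc a b) t) ^ 2)

/-- `u` solves the two-point boundary value problem
`-(a2 u')' + a0 u = f` on `(a,b)`, `u(a) = 0`, `u'(b) = 0`. -/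
def SolvesBVP (a b : ℝ) (a2 a0 f u : ℝ → ℝ) : Prop :=
  (∀ x ∈ Set.Ioo a b,
    -(derivWithin (fun t => a2 t * derivWithin u (Set.Icc a b) t) (Set.Icc a b) x)
      + a0 x * u x = f x) ∧
  u a = 0 ∧ derivWithin u (Set.Icc a b) b = 0

lemma aux_cs (c d : ℝ) (hcd : c ≤ d) (φ : ℝ → ℝ) (hφ : ContinuousOn φ (Icc c d)) :
    (∫ t in c..d, φ t) ^ 2 ≤ (d - c) * ∫ t in c..d, φ t ^ 2 := by
  rcases hcd.eq_or_lt with rfl | hlt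
  · simp
  have hL : 0 < d - c := sub_pos.2 hlt
  have h1 : IntervalIntegrable φ volume c d := hφ.intervalIntegrable_of_Icc hcd
  have h2 : IntervalIntegrable (fun t => φ t ^ 2) volume c d :=
    (hφ.pow 2).intervalIntegrable_of_Icc hcd
  set I := ∫ t in c..d, φ t with hI
  have h0 : 0 ≤ ∫ t in c..d, (φ t - I / (d - c)) ^ 2 :=
    intervalIntegral.integral_nonneg hcd (fun t _ => sq_nonneg _)
  have h3 : ∫ t in c..d, (φ t - I / (d - c)) ^ 2
      = (∫ t in c..d, φ t ^ 2) - 2 * (I / (d - c)) * I + (I / (d - c)) ^ 2 * (d - c) := by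
    have : ∀ t, (φ t - I / (d - c)) ^ 2
        = φ t ^ 2 - 2 * (I / (d - c)) * φ t + (I / (d - c)) ^ 2 := fun t => by ring
    simp_rw [this]
    rw [intervalIntegral.integral_add (h2.sub (h1.const_mul _)) (by simp),
      intervalIntegral.integral_sub h2 (h1.const_mul _), intervalIntegral.integral_const_mul]
    simp only [intervalIntegral.integral_const, smul_eq_mul, ← hI]
    ring
  rw [h3] at h0
  have h4 : (∫ t in c..d, φ t ^ 2) - 2 * (I / (d - c)) * I + (I / (d - c)) ^ 2 * (d - c)
    = (∫ t in c..d, φ t ^ 2) - I ^ 2 / (d - c) := by field_simp; ring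
  rw [h4] at h0
  have := (div_le_iff₀ hL).1 (sub_nonneg.1 h0)
  linarith

lemma aux_poincare (c d : ℝ) (hcd : c ≤ d) (F φ : ℝ → ℝ) (hF : ContinuousOn F (Icc c d))
    (hφ : ContinuousOn φ (Icc c d)) (hd : ∀ t ∈ Ioo c d, HasDerivAt F (φ t) t) (h0 : F c = 0) :
    ∫ t in c..d, F t ^ 2 ≤ (d - c) ^ 2 * ∫ t in c..d, φ t ^ 2 := by
  have h2 : IntervalIntegrable (fun t => φ t ^ 2) volume c d :=
    (hφ.pow 2).intervalIntegrable_of_Icc hcd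
  have key : ∀ t ∈ Icc c d, F t ^ 2 ≤ (d - c) * ∫ t in c..d, φ t ^ 2 := by
    intro t ht
    have hsub : Icc c t ⊆ Icc c d := Icc_subset_Icc_right ht.2
    have hft : ∫ y in c..t, φ y = F t - F c :=
      intervalIntegral.integral_eq_sub_of_hasDerivAt_of_le ht.1 (hF.mono hsub)
        (fun y hy => hd y ⟨hy.1, hy.2.trans_le ht.2⟩)
        ((hφ.mono hsub).intervalIntegrable_of_Icc ht.1)
    have := aux_cs c t ht.1 φ (hφ.mono hsub)
    rw [hft, h0, sub_zero] at this
    refine this.trans ?_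
    have hm : ∫ y in c..t, φ y ^ 2 ≤ ∫ y in c..d, φ y ^ 2 :=
      intervalIntegral.integral_mono_interval le_rfl ht.1 ht.2
        (Filter.Eventually.of_forall fun y => sq_nonneg _) h2
    have hn : 0 ≤ ∫ y in c..t, φ y ^ 2 :=
      intervalIntegral.integral_nonneg ht.1 (fun t _ => sq_nonneg _)
    exact mul_le_mul (by linarith [ht.2]) hm hn (by linarith)
  calc ∫ t in c..d, F t ^ 2 ≤ ∫ t in c..d, ((d - c) * ∫ t in c..d, φ t ^ 2) :=
        intervalIntegral.integral_mono_on hcd ((hF.pow 2).intervalIntegrable_of_Icc hcd)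
          (by simp) key
    _ = _ := by simp only [intervalIntegral.integral_const, smul_eq_mul]; ring

lemma aux_antideriv (p : Polynomial ℝ) (n : ℕ) (hp : p.degree < (n : WithBot ℕ)) (c y : ℝ) :
    ∃ P : Polynomial ℝ, P.derivative = p ∧ P.degree < ((n + 1 : ℕ) : WithBot ℕ) ∧
      P.eval c = y := by
  obtain ⟨P, hP, hd⟩ : ∃ P : Polynomial ℝ, P.derivative = p ∧
      P.degree < ((n + 1 : ℕ) : WithBot ℕ) := by
    rcases eq_or_ne p 0 with rfl | hp0
    · exact ⟨0, by simp, by simp⟩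
    refine ⟨∑ i ∈ Finset.range n, Polynomial.C (p.coeff i / (i + 1)) * Polynomial.X ^ (i + 1),
      ?_, ?_⟩
    · rw [Polynomial.derivative_sum]
      conv_rhs => rw [p.as_sum_range' n ((Polynomial.natDegree_lt_iff_degree_lt hp0).2 hp)]
      refine Finset.sum_congr rfl fun i _ => ?_
      rw [Polynomial.derivative_C_mul_X_pow, ← Polynomial.C_mul_X_pow_eq_monomial]
      have : ((i : ℝ) + 1) ≠ 0 := by positivity
      congr 2
      push_cast
      field_simp
    · rw [← Polynomial.mem_degreeLT]
      refine Submodule.sum_mem _ fun i hi => ?_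
      rw [Polynomial.mem_degreeLT]
      refine (Polynomial.degree_C_mul_X_pow_le _ _).trans_lt ?_
      have := Finset.mem_range.1 hi
      exact_mod_cast (by omega)
  refine ⟨P + Polynomial.C (y - P.eval c), by simp [hP], ?_, by simp⟩
  refine (Polynomial.degree_add_le _ _).trans_lt (max_lt hd ?_)
  exact Polynomial.degree_C_le.trans_lt (by exact_mod_cast Nat.succ_pos n)

lemma aux_hasDerivAt {a b c d : ℝ} (hac : a ≤ c) (hdb : d ≤ b) {g : ℝ → ℝ}
    (hg : ContDiffOn ℝ 1 g (Icc a b)) : ∀ t ∈ Ioo c d,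
      HasDerivAt g (derivWithin g (Icc a b) t) t := by
  intro t ht
  have h1 : a < t := hac.trans_lt ht.1
  have h2 : t < b := ht.2.trans_le hdb
  have := (hg.differentiableOn one_ne_zero t ⟨h1.le, h2.le⟩).hasDerivWithinAt
  exact this.hasDerivAt (Icc_mem_nhds h1 h2)

lemma aux_taylor {a b c d : ℝ} (hab : a < b) (hac : a ≤ c) (hcd : c ≤ d) (hdb : d ≤ b) (m : ℕ) :
    ∀ g : ℝ → ℝ, ContDiffOn ℝ m g (Icc a b) → ∃ T : Polynomial ℝ, T.degree < (m : WithBot ℕ) ∧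
      ∫ t in c..d, (g t - T.eval t) ^ 2 ≤
        (d - c) ^ (2 * m) * ∫ t in c..d, (iteratedDerivWithin m g (Icc a b) t) ^ 2 := by
  have hsub : Icc c d ⊆ Icc a b := Icc_subset_Icc hac hdb
  induction m with
  | zero => intro g _; exact ⟨0, by simp, by simp⟩
  | succ m ih =>
    intro g hg
    have hg1 : ContDiffOn ℝ 1 g (Icc a b) := hg.of_le (by exact_mod_cast Nat.succ_pos m)
    have hg' : ContDiffOn ℝ m (derivWithin g (Icc a b)) (Icc a b) :=
      hg.derivWithin (uniqueDiffOn_Icc hab) (by push_cast; exact le_rfl)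
    obtain ⟨T, hT, hTi⟩ := ih _ hg'
    obtain ⟨P, hP, hPd, hPc⟩ := aux_antideriv T m hT c (g c)
    refine ⟨P, hPd, ?_⟩
    have := aux_poincare c d hcd (fun t => g t - P.eval t)
      (fun t => derivWithin g (Icc a b) t - T.eval t)
      ((hg.continuousOn.mono hsub).sub P.continuousOn)
      ((hg'.continuousOn.mono hsub).sub T.continuousOn)
      (fun t ht => by
        have := (aux_hasDerivAt hac hdb hg1 t ht).sub (P.hasDerivAt t)
        rwa [hP] at this) (by simp [hPc])
    refine this.trans ?_
    rw [iteratedDerivWithin_succ', show 2 * (m + 1) = 2 + 2 * m by ring, pow_add, mul_assoc]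
    exact mul_le_mul_of_nonneg_left hTi (sq_nonneg _)

lemma aux_int (p q : Polynomial ℝ) (c d : ℝ) :
    IntervalIntegrable (fun t => p.eval t * q.eval t) volume c d :=
  (p.continuous.mul q.continuous).intervalIntegrable _ _

lemma aux_proj (l : ℕ) (c d : ℝ) (hcd : c < d) (g : ℝ → ℝ) (hg : ContinuousOn g (Icc c d)) :
    ∃ p, IsL2Proj l c d g p := by
  let V := Polynomial.degreeLT ℝ (l + 1)
  have : Module.Finite ℝ V := Module.Finite.equiv (Polynomial.degreeLTEquiv ℝ (l + 1)).symm
  let L : V →ₗ[ℝ] Module.Dual ℝ V := LinearMap.mk₂ ℝ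
    (fun p q => ∫ t in c..d, p.1.eval t * q.1.eval t)
    (fun p p' q => by
      rw [← intervalIntegral.integral_add (aux_int _ _ _ _) (aux_int _ _ _ _)]
      simp [add_mul])
    (fun r p q => by
      rw [smul_eq_mul, ← intervalIntegral.integral_const_mul]
      simp [mul_assoc])
    (fun p q q' => by
      rw [← intervalIntegral.integral_add (aux_int _ _ _ _) (aux_int _ _ _ _)]
      simp [mul_add])
    (fun r p q => by
      rw [smul_eq_mul, ← intervalIntegral.integral_const_mul]
      simp [mul_left_comm])
  have hgi : ∀ q : Polynomial ℝ, IntervalIntegrable (fun t => g t * q.eval t) volume c d :=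
    fun q => (hg.mul q.continuousOn).intervalIntegrable_of_Icc hcd.le
  let G : Module.Dual ℝ V :=
    { toFun := fun q => ∫ t in c..d, g t * q.1.eval t
      map_add' := fun q q' => by
        rw [← intervalIntegral.integral_add (hgi _) (hgi _)]
        simp [mul_add]
      map_smul' := fun r q => by
        simp only [RingHom.id_apply]
        rw [smul_eq_mul, ← intervalIntegral.integral_const_mul]
        simp [mul_left_comm] }
  have hinj : Function.Injective L := by
    rw [← LinearMap.ker_eq_bot, LinearMap.ker_eq_bot']
    intro p hp
    have h0 : ∫ t in c..d, p.1.eval t * p.1.eval t = 0 := LinearMap.congr_fun hp p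
    have hz : ∀ t ∈ Icc c d, p.1.eval t * p.1.eval t = 0 := by
      by_contra! hne
      obtain ⟨t, ht, hne⟩ := hne
      have := intervalIntegral.integral_pos hcd
        (p.1.continuous.mul p.1.continuous).continuousOn
        (fun x _ => mul_self_nonneg (p.1.eval x))
        ⟨t, ht, lt_of_le_of_ne (mul_self_nonneg (p.1.eval t)) hne.symm⟩
      exact this.ne' h0
    apply Subtype.ext
    refine Polynomial.eq_zero_of_infinite_isRoot _ ((Icc_infinite hcd).mono fun t ht => ?_)
    exact mul_self_eq_zero.1 (hz t ht)
  have hsurj : Function.Surjective L :=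
    (LinearMap.injective_iff_surjective_of_finrank_eq_finrank
      (Subspace.dual_finrank_eq (K := ℝ) (V := V)).symm).1 hinj
  obtain ⟨p, hp⟩ := hsurj G
  have hdeg : ∀ q : Polynomial ℝ, q.degree ≤ (l : WithBot ℕ) ↔ q ∈ V := by
    intro q
    rw [Polynomial.mem_degreeLT, Polynomial.degree_lt_iff_coeff_zero,
      Polynomial.degree_le_iff_coeff_zero]
    refine forall_congr' fun m => ?_
    rw [Nat.cast_lt, Nat.succ_le_iff]
  refine ⟨p.1, (hdeg _).2 p.2, fun q hq => ?_⟩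
  have := LinearMap.congr_fun hp ⟨q, (hdeg q).1 hq⟩
  have h1 : ∫ t in c..d, p.1.eval t * q.eval t = ∫ t in c..d, g t * q.eval t := this
  simp_rw [sub_mul]
  rw [intervalIntegral.integral_sub (hgi q) (aux_int _ _ _ _), h1, sub_self]

lemma aux_best (l : ℕ) (c d : ℝ) (hcd : c ≤ d) (g : ℝ → ℝ) (hg : ContinuousOn g (Icc c d))
    (p T : Polynomial ℝ) (hp : IsL2Proj l c d g p) (hT : T.degree ≤ (l : WithBot ℕ)) :
    ∫ t in c..d, (g t - p.eval t) ^ 2 ≤ ∫ t in c..d, (g t - T.eval t) ^ 2 := by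
  have h1 : ContinuousOn (fun t => g t - p.eval t) (Icc c d) := hg.sub p.continuousOn
  have ho := hp.2 (p - T) ((Polynomial.degree_sub_le _ _).trans (max_le hp.1 hT))
  have e : ∀ t, (g t - T.eval t) ^ 2 = (g t - p.eval t) ^ 2
      + 2 * ((g t - p.eval t) * (p - T).eval t) + ((p - T).eval t) ^ 2 := fun t => by
    simp only [Polynomial.eval_sub]; ring
  simp_rw [e]
  have i1 : IntervalIntegrable (fun t => (g t - p.eval t) ^ 2) volume c d :=
    (h1.pow 2).intervalIntegrable_of_Icc hcd
  have i2 : IntervalIntegrable (fun t => 2 * ((g t - p.eval t) * (p - T).eval t)) volume c d :=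
    ((h1.mul (p - T).continuousOn).intervalIntegrable_of_Icc hcd).const_mul 2
  have i3 : IntervalIntegrable (fun t => ((p - T).eval t) ^ 2) volume c d :=
    ((p - T).continuous.pow 2).intervalIntegrable c d
  rw [intervalIntegral.integral_add (i1.add i2) i3, intervalIntegral.integral_add i1 i2,
    intervalIntegral.integral_const_mul, ho]
  have : 0 ≤ ∫ t in c..d, ((p - T).eval t) ^ 2 :=
    intervalIntegral.integral_nonneg hcd (fun t _ => sq_nonneg _)
  linarith

lemma aux_gint {c d : ℝ} (hcd : c ≤ d) {g : ℝ → ℝ} (hg : ContinuousOn g (Icc c d))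
    (q : Polynomial ℝ) : IntervalIntegrable (fun t => g t * q.eval t) volume c d :=
  (hg.mul q.continuousOn).intervalIntegrable_of_Icc hcd

lemma aux_projerr {a b c d : ℝ} (hab : a < b) (hac : a ≤ c) (hcd : c ≤ d) (hdb : d ≤ b) (m l : ℕ)
    (hml : m ≤ l + 1) (g : ℝ → ℝ) (hg : ContDiffOn ℝ m g (Icc a b)) (p : Polynomial ℝ)
    (hp : IsL2Proj l c d g p) :
    ∫ t in c..d, (g t - p.eval t) ^ 2 ≤
      (d - c) ^ (2 * m) * ∫ t in c..d, (iteratedDerivWithin m g (Icc a b) t) ^ 2 := by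
  obtain ⟨T, hT, hTi⟩ := aux_taylor hab hac hcd hdb m g hg
  refine (aux_best l c d hcd g (hg.continuousOn.mono (Icc_subset_Icc hac hdb)) p T hp ?_).trans hTi
  rw [Polynomial.degree_le_iff_coeff_zero]
  rw [Polynomial.degree_lt_iff_coeff_zero] at hT
  intro n hn
  have : l < n := by exact_mod_cast hn
  exact hT n (by omega)

lemma aux_sigma {a b c d : ℝ} (hab : a < b) (hac : a ≤ c) (hcd : c < d) (hdb : d ≤ b) (m k : ℕ)
    (hmk : m ≤ k) (g : ℝ → ℝ) (hg : ContDiffOn ℝ (m + 1) g (Icc a b)) :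
    ∃ q : Polynomial ℝ, q.degree ≤ ((k + 1 : ℕ) : WithBot ℕ) ∧ q.eval c = g c ∧ q.eval d = g d ∧
      (∀ v : Polynomial ℝ, v.degree ≤ (k : WithBot ℕ) →
        ∫ t in c..d, derivWithin g (Icc a b) t * v.eval t
          = ∫ t in c..d, q.derivative.eval t * v.eval t) ∧
      ∫ t in c..d, (g t - q.eval t) ^ 2 ≤
        (d - c) ^ (2 * (m + 1)) *
          ∫ t in c..d, (iteratedDerivWithin (m + 1) g (Icc a b) t) ^ 2 := by
  have hsub : Icc c d ⊆ Icc a b := Icc_subset_Icc hac hdb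
  have hg1 : ContDiffOn ℝ 1 g (Icc a b) := hg.of_le (by simp)
  have hg' : ContDiffOn ℝ m (derivWithin g (Icc a b)) (Icc a b) :=
    hg.derivWithin (uniqueDiffOn_Icc hab) le_rfl
  have hgc' := hg'.continuousOn.mono hsub
  obtain ⟨p, hp⟩ := aux_proj k c d hcd _ hgc'
  have hpd : p.degree < ((k + 1 : ℕ) : WithBot ℕ) :=
    hp.1.trans_lt (by exact_mod_cast Nat.lt_succ_self k)
  obtain ⟨q, hq, hqd, hqc⟩ := aux_antideriv p (k + 1) hpd c (g c)
  have hqd' : q.degree ≤ ((k + 1 : ℕ) : WithBot ℕ) := by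
    rw [Polynomial.degree_le_iff_coeff_zero]
    rw [Polynomial.degree_lt_iff_coeff_zero] at hqd
    intro n hn
    have : k + 1 < n := by exact_mod_cast hn
    exact hqd n (by omega)
  have horth : ∀ v : Polynomial ℝ, v.degree ≤ (k : WithBot ℕ) →
        ∫ t in c..d, derivWithin g (Icc a b) t * v.eval t
          = ∫ t in c..d, q.derivative.eval t * v.eval t := by
    intro v hv
    have := hp.2 v hv
    simp_rw [sub_mul] at this
    rw [intervalIntegral.integral_sub
      (aux_gint hcd.le hgc' v) (aux_int _ _ _ _)] at this
    rw [hq]; linarith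
  refine ⟨q, hqd', hqc, ?_, horth, ?_⟩
  · have h1 := horth 1 (Polynomial.degree_one_le.trans (by exact_mod_cast Nat.zero_le k))
    simp only [Polynomial.eval_one, mul_one] at h1
    rw [intervalIntegral.integral_eq_sub_of_hasDerivAt_of_le hcd.le (hg.continuousOn.mono hsub)
      (aux_hasDerivAt hac hdb hg1) (hgc'.intervalIntegrable_of_Icc hcd.le),
      intervalIntegral.integral_eq_sub_of_hasDerivAt (fun t _ => q.hasDerivAt t)
        (q.derivative.continuous.intervalIntegrable _ _)] at h1
    linarith
  · have := aux_poincare c d hcd.le (fun t => g t - q.eval t)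
      (fun t => derivWithin g (Icc a b) t - p.eval t)
      ((hg.continuousOn.mono hsub).sub q.continuousOn)
      (hgc'.sub p.continuousOn)
      (fun t ht => by
        have := (aux_hasDerivAt hac hdb hg1 t ht).sub (q.hasDerivAt t)
        rwa [hq] at this) (by simp [hqc])
    refine this.trans ?_
    rw [iteratedDerivWithin_succ', show 2 * (m + 1) = 2 + 2 * m by ring, pow_add, mul_assoc]
    exact mul_le_mul_of_nonneg_left
      (aux_projerr hab hac hcd.le hdb m k (by omega) _ hg' p hp) (sq_nonneg _)

lemma aux_weak {a b c d : ℝ} (hab : a < b) (hac : a ≤ c) (hcd : c < d) (hdb : d ≤ b) (k : ℕ)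
    (u : ℝ → ℝ) (hu : ContDiffOn ℝ 1 u (Icc a b)) (P Q : Polynomial ℝ)
    (hP : IsL2Proj (k + 1) c d (derivWithin u (Icc a b)) P) (hQ : IsL2Proj k c d u Q) :
    IsWeakDeriv (k + 1) c d (fun t => Q.eval t) (u c) (u d) P := by
  have hsub : Icc c d ⊆ Icc a b := Icc_subset_Icc hac hdb
  have huc := hu.continuousOn.mono hsub
  have hu'c := (hu.continuousOn_derivWithin (uniqueDiffOn_Icc hab) le_rfl).mono hsub
  refine ⟨hP.1, fun q hq => ?_⟩
  have h1 := hP.2 q hq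
  have hq' : q.derivative.degree ≤ (k : WithBot ℕ) := by
    rw [Polynomial.degree_le_iff_coeff_zero] at hq ⊢
    intro n hn
    have : k < n := by exact_mod_cast hn
    rw [Polynomial.coeff_derivative, hq (n + 1) (by exact_mod_cast (by omega)), zero_mul]
  have h2 := hQ.2 _ hq'
  simp_rw [sub_mul] at h1 h2
  rw [intervalIntegral.integral_sub
      (aux_gint hcd.le hu'c q) (aux_int _ _ _ _)] at h1
  rw [intervalIntegral.integral_sub
      (aux_gint hcd.le huc q.derivative)
      (aux_int _ _ _ _)] at h2
  have h3 := intervalIntegral.integral_mul_deriv_eq_deriv_mul_of_hasDerivAt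
    (a := c) (b := d) (u := u) (u' := derivWithin u (Icc a b)) (v := fun t => q.eval t)
    (v' := fun t => q.derivative.eval t)
    (by rwa [uIcc_of_le hcd.le]) q.continuousOn
    (by rw [min_eq_left hcd.le, max_eq_right hcd.le]; exact aux_hasDerivAt hac hdb hu)
    (fun t _ => q.hasDerivAt t) (hu'c.intervalIntegrable_of_Icc hcd.le)
    (q.derivative.continuous.intervalIntegrable _ _)
  linarith

lemma aux_weak_sub {r : ℕ} {c d : ℝ} {v w D E : Polynomial ℝ} {vl vr wl wr : ℝ}
    (h1 : IsWeakDeriv r c d (fun t => v.eval t) vl vr D)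
    (h2 : IsWeakDeriv r c d (fun t => w.eval t) wl wr E) :
    IsWeakDeriv r c d (fun t => (v - w).eval t) (vl - wl) (vr - wr) (D - E) := by
  refine ⟨(Polynomial.degree_sub_le _ _).trans (max_le h1.1 h2.1), fun q hq => ?_⟩
  have e1 := h1.2 q hq
  have e2 := h2.2 q hq
  simp only [Polynomial.eval_sub, sub_mul]
  rw [intervalIntegral.integral_sub (aux_int _ _ _ _) (aux_int _ _ _ _),
    intervalIntegral.integral_sub (aux_int _ _ _ _) (aux_int _ _ _ _), e1, e2]
  ring

/-- integrability helper -/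
lemma aux_ii {a b c d : ℝ} (hac : a ≤ c) (hcd : c ≤ d) (hdb : d ≤ b) {F : ℝ → ℝ}
    (hF : ContinuousOn F (Icc a b)) : IntervalIntegrable F volume c d :=
  (hF.mono (Icc_subset_Icc hac hdb)).intervalIntegrable_of_Icc hcd

/-- load term on one element -/
lemma aux_load {a b c d : ℝ} (hac : a ≤ c) (hcd : c < d) (hdb : d ≤ b) (k : ℕ)
    (a0 f u g : ℝ → ℝ) (ha0 : ContinuousOn a0 (Icc a b)) (hu : ContinuousOn u (Icc a b))
    (hg' : ContinuousOn (derivWithin g (Icc a b)) (Icc a b))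
    (heq : ∀ t ∈ Ioo a b, -(derivWithin g (Icc a b) t) + a0 t * u t = f t)
    (q : Polynomial ℝ) (hqd : q.degree ≤ ((k + 1 : ℕ) : WithBot ℕ)) (hqc : q.eval c = g c)
    (hqe : q.eval d = g d)
    (hq : ∀ v : Polynomial ℝ, v.degree ≤ (k : WithBot ℕ) →
        ∫ t in c..d, derivWithin g (Icc a b) t * v.eval t
          = ∫ t in c..d, q.derivative.eval t * v.eval t)
    (e D : Polynomial ℝ) (el er : ℝ) (he : e.degree ≤ (k : WithBot ℕ))
    (hD : IsWeakDeriv (k + 1) c d (fun t => e.eval t) el er D) :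
    ∫ t in c..d, f t * e.eval t = (∫ t in c..d, q.eval t * D.eval t)
      + (∫ t in c..d, a0 t * u t * e.eval t) - (er * g d - el * g c) := by
  have h1 : ∫ t in c..d, f t * e.eval t
      = ∫ t in c..d, (a0 t * u t * e.eval t - derivWithin g (Icc a b) t * e.eval t) := by
    refine intervalIntegral.integral_congr_Ioo_of_le hcd.le fun t ht => ?_
    show f t * e.eval t = a0 t * u t * e.eval t - derivWithin g (Icc a b) t * e.eval t
    rw [← heq t ⟨hac.trans_lt ht.1, ht.2.trans_le hdb⟩]
    ring
  rw [h1, intervalIntegral.integral_sub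
    (aux_gint (g := fun t => a0 t * u t) hcd.le ((ha0.mul hu).mono (Icc_subset_Icc hac hdb) :
      ContinuousOn (fun t => a0 t * u t) (Icc c d)) e)
    (aux_gint hcd.le (hg'.mono (Icc_subset_Icc hac hdb)) e), hq e he]
  have h2 := hD.2 q hqd
  rw [hqc, hqe] at h2
  simp only [mul_comm (D.eval _), mul_comm (e.eval _)] at h2
  linarith

/-- coercivity on one element -/
lemma aux_elem {a b c d amin : ℝ} (hamin : 0 < amin) (hac : a ≤ c) (hcd : c < d) (hdb : d ≤ b)
    (a2 a0 u w : ℝ → ℝ) (M : ℝ) (ha2 : ContinuousOn a2 (Icc a b))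
    (ha0 : ContinuousOn a0 (Icc a b))
    (hu : ContinuousOn u (Icc a b)) (hw : ContinuousOn w (Icc a b))
    (ha2lb : ∀ t ∈ Icc a b, amin ≤ a2 t) (ha0nn : ∀ t ∈ Icc a b, 0 ≤ a0 t)
    (ha2ub : ∀ t ∈ Icc a b, a2 t ≤ M) (ha0ub : ∀ t ∈ Icc a b, a0 t ≤ M)
    (P Q q U V : Polynomial ℝ) :
    ∫ t in c..d, (U.eval t - w t) ^ 2 ≤
      (4 / amin) * ((∫ t in c..d, a2 t * U.eval t * (U - P).eval t)
        + (∫ t in c..d, a0 t * V.eval t * (V - Q).eval t)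
        - (∫ t in c..d, q.eval t * (U - P).eval t)
        - (∫ t in c..d, a0 t * u t * (V - Q).eval t))
      + (4 / amin ^ 2) * (∫ t in c..d, (a2 t * w t - q.eval t) ^ 2)
      + (4 * M ^ 2 / amin ^ 2 + 2) * (∫ t in c..d, (w t - P.eval t) ^ 2)
      + (2 * M / amin) * (∫ t in c..d, (u t - Q.eval t) ^ 2) := by
  have i0 : IntervalIntegrable (fun t => (U.eval t - w t) ^ 2) volume c d :=
    aux_ii hac hcd.le hdb ((U.continuousOn.sub hw).pow 2)
  have i1 : IntervalIntegrable (fun t => a2 t * U.eval t * (U - P).eval t) volume c d :=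
    aux_ii hac hcd.le hdb ((ha2.mul U.continuousOn).mul (U - P).continuousOn)
  have i2 : IntervalIntegrable (fun t => a0 t * V.eval t * (V - Q).eval t) volume c d :=
    aux_ii hac hcd.le hdb ((ha0.mul V.continuousOn).mul (V - Q).continuousOn)
  have i3 : IntervalIntegrable (fun t => q.eval t * (U - P).eval t) volume c d := aux_int _ _ _ _
  have i4 : IntervalIntegrable (fun t => a0 t * u t * (V - Q).eval t) volume c d :=
    aux_ii hac hcd.le hdb ((ha0.mul hu).mul (V - Q).continuousOn)
  have i5 : IntervalIntegrable (fun t => (a2 t * w t - q.eval t) ^ 2) volume c d :=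
    aux_ii hac hcd.le hdb (((ha2.mul hw).sub q.continuousOn).pow 2)
  have i6 : IntervalIntegrable (fun t => (w t - P.eval t) ^ 2) volume c d :=
    aux_ii hac hcd.le hdb ((hw.sub P.continuousOn).pow 2)
  have i7 : IntervalIntegrable (fun t => (u t - Q.eval t) ^ 2) volume c d :=
    aux_ii hac hcd.le hdb ((hu.sub Q.continuousOn).pow 2)
  rw [← intervalIntegral.integral_add i1 i2, ← intervalIntegral.integral_sub (i1.add i2) i3,
    ← intervalIntegral.integral_sub ((i1.add i2).sub i3) i4,
    ← intervalIntegral.integral_const_mul, ← intervalIntegral.integral_const_mul,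
    ← intervalIntegral.integral_const_mul, ← intervalIntegral.integral_const_mul,
    ← intervalIntegral.integral_add ((((i1.add i2).sub i3).sub i4).const_mul _) (i5.const_mul _),
    ← intervalIntegral.integral_add
      (((((i1.add i2).sub i3).sub i4).const_mul _).add (i5.const_mul _)) (i6.const_mul _),
    ← intervalIntegral.integral_add
      ((((((i1.add i2).sub i3).sub i4).const_mul _).add (i5.const_mul _)).add (i6.const_mul _))
      (i7.const_mul _)]
  refine intervalIntegral.integral_mono_on hcd.le i0
    ((((((i1.add i2).sub i3).sub i4).const_mul _).add (i5.const_mul _)).add (i6.const_mul _)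
      |>.add (i7.const_mul _)) fun t ht => ?_
  have ht' := Icc_subset_Icc hac hdb ht
  simp only [Polynomial.eval_sub]
  have b1 := ha2lb t ht'
  have b2 := ha2ub t ht'
  have b3 := ha0nn t ht'
  have b4 := ha0ub t ht'
  generalize a2 t = A at *
  generalize a0 t = B at *
  generalize w t = W at *
  generalize u t = Y at *
  generalize U.eval t = X at *
  generalize P.eval t = R at *
  generalize V.eval t = Z at *
  generalize Q.eval t = S at *
  generalize q.eval t = q at *
  -- De = X - R, e0 = Z - S
  have s1 : (X - W) ^ 2 ≤ 2 * (X - R) ^ 2 + 2 * (W - R) ^ 2 := by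
    nlinarith [sq_nonneg (X - R + (W - R))]
  have s2 : amin / 2 * (X - R) ^ 2 ≤ (A * X * (X - R) + B * Z * (Z - S) - q * (X - R)
      - B * Y * (Z - S)) + 1 / (2 * amin) * (A * R - q) ^ 2 + 1 / 2 * M * (Y - S) ^ 2 := by
    have y1 : 0 ≤ amin / 2 * (X - R) ^ 2 + (A * R - q) * (X - R)
        + 1 / (2 * amin) * (A * R - q) ^ 2 := by
      have : amin / 2 * (X - R) ^ 2 + (A * R - q) * (X - R)
        + 1 / (2 * amin) * (A * R - q) ^ 2
        = 1 / (2 * amin) * (amin * (X - R) + (A * R - q)) ^ 2 := by field_simp; ring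
      rw [this]; positivity
    have y2 : amin * (X - R) ^ 2 ≤ A * (X - R) ^ 2 :=
      mul_le_mul_of_nonneg_right b1 (sq_nonneg _)
    have y3 : B * (Y - S) ^ 2 ≤ M * (Y - S) ^ 2 :=
      mul_le_mul_of_nonneg_right b4 (sq_nonneg _)
    have y4 : 0 ≤ B * ((Z - S) - (Y - S)) ^ 2 := mul_nonneg b3 (sq_nonneg _)
    have y5 : 0 ≤ B * (Z - S) ^ 2 := mul_nonneg b3 (sq_nonneg _)
    nlinarith
  have s3 : (A * R - q) ^ 2 ≤ 2 * (A * W - q) ^ 2 + 2 * M ^ 2 * (W - R) ^ 2 := by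
    have z1 : A ^ 2 ≤ M ^ 2 := pow_le_pow_left₀ (hamin.le.trans b1) b2 2
    have z2 := mul_le_mul_of_nonneg_right z1 (sq_nonneg (W - R))
    nlinarith [sq_nonneg ((A * W - q) + A * (W - R))]
  have s4 : 1 / (2 * amin) * (A * R - q) ^ 2 ≤
      1 / (2 * amin) * (2 * (A * W - q) ^ 2 + 2 * M ^ 2 * (W - R) ^ 2) :=
    mul_le_mul_of_nonneg_left s3 (by positivity)
  have s5 := mul_le_mul_of_nonneg_left (s2.trans (by gcongr : _ ≤ (A * X * (X - R)
      + B * Z * (Z - S) - q * (X - R) - B * Y * (Z - S))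
      + 1 / (2 * amin) * (2 * (A * W - q) ^ 2 + 2 * M ^ 2 * (W - R) ^ 2)
      + 1 / 2 * M * (Y - S) ^ 2)) (by positivity : 0 ≤ 4 / amin)
  have s6 : 4 / amin * (amin / 2 * (X - R) ^ 2) = 2 * (X - R) ^ 2 := by field_simp; ring
  rw [s6] at s5
  refine s1.trans ((add_le_add_left s5 _).trans (le_of_eq ?_))
  field_simp
  ring

lemma aux_leib {a b : ℝ} (hab : a < b) (s : ℕ) (a2 : ℝ → ℝ)
    (ha2 : ContDiffOn ℝ (s + 1) a2 (Icc a b)) :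
    ∃ K : ℝ, 0 ≤ K ∧ ∀ u : ℝ → ℝ, ContDiffOn ℝ (s + 2) u (Icc a b) → ∀ t ∈ Icc a b,
      (iteratedDerivWithin (s + 1) (fun t => a2 t * derivWithin u (Icc a b) t) (Icc a b) t) ^ 2
        ≤ K * ∑ j ∈ Finset.range (s + 2 + 1), (iteratedDerivWithin j u (Icc a b) t) ^ 2 := by
  have hud := uniqueDiffOn_Icc hab
  have hB : ∀ i ∈ Finset.range (s + 1 + 1), ∃ B : ℝ, ∀ t ∈ Icc a b,
      (iteratedDerivWithin i a2 (Icc a b) t) ^ 2 ≤ B := by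
    intro i hi
    have hi' : i ≤ s + 1 := by simpa [Nat.lt_succ_iff] using hi
    have hc := ha2.continuousOn_iteratedDerivWithin (m := i) (by exact_mod_cast hi') hud
    obtain ⟨B, hB⟩ := isCompact_Icc.bddAbove_image (hc.pow 2)
    exact ⟨B, fun t ht => hB ⟨t, ht, rfl⟩⟩
  choose! B hB using hB
  have hB0 : ∀ i ∈ Finset.range (s + 1 + 1), 0 ≤ B i := fun i hi =>
    (sq_nonneg _).trans (hB i hi a ⟨le_rfl, hab.le⟩)
  refine ⟨(s + 1 + 1 : ℕ) * ∑ i ∈ Finset.range (s + 1 + 1), ((s + 1).choose i : ℝ) ^ 2 * B i,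
    mul_nonneg (by positivity)
      (Finset.sum_nonneg fun i hi => mul_nonneg (by positivity) (hB0 i hi)), ?_⟩
  intro u hu t ht
  have hu' : ContDiffOn ℝ (s + 1) (derivWithin u (Icc a b)) (Icc a b) :=
    hu.derivWithin hud (by rw [add_assoc]; norm_num)
  have hmul := iteratedDerivWithin_mul (n := s + 1) ht hud
    (by exact_mod_cast ha2 t ht) (by exact_mod_cast hu' t ht)
  have hmul' : iteratedDerivWithin (s + 1) (fun t => a2 t * derivWithin u (Icc a b) t) (Icc a b) t
    = _ := hmul
  rw [hmul']
  refine sq_sum_le_card_mul_sum_sq.trans ?_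
  rw [Finset.card_range, mul_assoc, Finset.sum_mul]
  refine mul_le_mul_of_nonneg_left (Finset.sum_le_sum fun i hi => ?_) (by positivity)
  rw [mul_pow, mul_pow, ← iteratedDerivWithin_succ']
  refine mul_le_mul (mul_le_mul_of_nonneg_left (hB i hi t ht) (by positivity)) ?_
    (sq_nonneg _) (mul_nonneg (by positivity) (hB0 i hi))
  exact Finset.single_le_sum
    (f := fun j => (iteratedDerivWithin j u (Icc a b) t) ^ 2) (fun j _ => sq_nonneg _)
    (Finset.mem_range.2 (by omega))

/-- Theorem 4.4, estimate (4.16). Let `k ≥ 0`, `r = k + 1`, `0 ≤ s ≤ k`.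
Suppose `a2 ∈ C^{s+1}([a,b])` with `a2 ≥ a_min > 0` and `a0` continuous, nonnegative.
There is a constant `C > 0` independent of the partition such that for every partition with
mesh size `h`, if `u ∈ C^{s+2}([a,b])` solves the boundary value problem and `u_h ∈ S_h`
is the weak finite element solution, then `‖d_{w,r}u_h − u'‖_h ≤ C h^{s+1} ‖u‖_{s+2}`. -/
theorem error_estimate_H1 (k s : ℕ) (hs : s ≤ k) (a b amin : ℝ) (hab : a < b)
    (hamin : 0 < amin) (a2 a0 : ℝ → ℝ)
    (ha2 : ContDiffOn ℝ (s + 1) a2 (Set.Icc a b)) (ha2lb : ∀ t ∈ Set.Icc a b, amin ≤ a2 t)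
    (ha0c : ContinuousOn a0 (Set.Icc a b)) (ha0nn : ∀ t ∈ Set.Icc a b, 0 ≤ a0 t) :
    ∃ C > (0 : ℝ), ∀ (N : ℕ) (x : ℕ → ℝ), IsPartition N a b x →
      ∀ h : ℝ, (∀ i < N - 1, x (i + 1) - x i ≤ h) →
      ∀ f u : ℝ → ℝ, ContDiffOn ℝ (s + 2) u (Set.Icc a b) → SolvesBVP a b a2 a0 f u →
      ∀ (u0 : ℕ → Polynomial ℝ) (un : ℕ → ℝ) (Du : ℕ → Polynomial ℝ),
        IsWFESol k (k + 1) N x a2 a0 f u0 un Du →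
        Real.sqrt (∑ i ∈ Finset.range (N - 1),
            ∫ t in x i..x (i + 1), ((Du i).eval t - derivWithin u (Set.Icc a b) t) ^ 2)
          ≤ C * h ^ (s + 1) * sobNorm (s + 2) a b u := by
  have hud := uniqueDiffOn_Icc hab
  obtain ⟨K, hK0, hK⟩ := aux_leib hab s a2 ha2
  obtain ⟨M2, hM2⟩ := isCompact_Icc.bddAbove_image ha2.continuousOn
  obtain ⟨M0, hM0⟩ := isCompact_Icc.bddAbove_image ha0c
  set M := max M2 M0 with hM
  have ha2ub : ∀ t ∈ Icc a b, a2 t ≤ M := fun t ht => (hM2 ⟨t, ht, rfl⟩).trans (le_max_left _ _)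
  have ha0ub : ∀ t ∈ Icc a b, a0 t ≤ M := fun t ht => (hM0 ⟨t, ht, rfl⟩).trans (le_max_right _ _)
  have hMnn : 0 ≤ M := (ha0nn a ⟨le_rfl, hab.le⟩).trans (ha0ub a ⟨le_rfl, hab.le⟩)
  set C2 : ℝ := (4 / amin ^ 2) * K + (4 * M ^ 2 / amin ^ 2 + 2) + 2 * M / amin with hC2
  have hC2pos : 0 < C2 := by positivity
  refine ⟨Real.sqrt C2, Real.sqrt_pos.2 hC2pos, ?_⟩
  intro N x hx h hh f u hu hbvp u0 un Du hsol
  obtain ⟨hN, hx0, hxN, hxlt⟩ := hx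
  obtain ⟨heq, hua, hub⟩ := hbvp
  obtain ⟨⟨hu0d, hun0⟩, hDu, hvar⟩ := hsol
  have hmono : ∀ i j, i ≤ j → j ≤ N - 1 → x i ≤ x j := by
    intro i j hij
    induction j, hij using Nat.le_induction with
    | base => intro _; exact le_rfl
    | succ j hij ih => intro hj; exact (ih (by omega)).trans (hxlt j (by omega)).le
  have hxa : ∀ i ≤ N - 1, a ≤ x i := fun i hi => hx0 ▸ hmono 0 i (Nat.zero_le _) hi
  have hxb : ∀ i ≤ N - 1, x i ≤ b := fun i hi => hxN ▸ hmono i (N - 1) hi le_rfl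
  have hpos : 0 ≤ h := by
    have h1 := hh 0 (by omega)
    have h2 := hxlt 0 (by omega)
    linarith
  set w := derivWithin u (Icc a b) with hw
  have hwd : ContDiffOn ℝ (s + 1) w (Icc a b) := hu.derivWithin hud (by rw [add_assoc]; norm_num)
  set g : ℝ → ℝ := fun t => a2 t * w t with hg
  have hgd : ContDiffOn ℝ (s + 1) g (Icc a b) := ha2.mul hwd
  have hu1 : ContDiffOn ℝ 1 u (Icc a b) :=
    hu.of_le (by exact_mod_cast (by omega : 1 ≤ s + 2))
  have hus : ContDiffOn ℝ (s + 1 : ℕ) u (Icc a b) :=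
    hu.of_le (by exact_mod_cast (by omega : s + 1 ≤ s + 2))
  have hg'c : ContinuousOn (derivWithin g (Icc a b)) (Icc a b) :=
    hgd.continuousOn_derivWithin hud (by simp)
  have hex : ∀ i, i < N - 1 → ∃ P Q q : Polynomial ℝ,
      IsL2Proj (k + 1) (x i) (x (i + 1)) w P ∧ IsL2Proj k (x i) (x (i + 1)) u Q ∧
      q.degree ≤ ((k + 1 : ℕ) : WithBot ℕ) ∧ q.eval (x i) = g (x i) ∧
      q.eval (x (i + 1)) = g (x (i + 1)) ∧
      (∀ v : Polynomial ℝ, v.degree ≤ (k : WithBot ℕ) →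
        ∫ t in x i..x (i + 1), derivWithin g (Icc a b) t * v.eval t
          = ∫ t in x i..x (i + 1), q.derivative.eval t * v.eval t) ∧
      ∫ t in x i..x (i + 1), (g t - q.eval t) ^ 2 ≤
        (x (i + 1) - x i) ^ (2 * (s + 1)) *
          ∫ t in x i..x (i + 1), (iteratedDerivWithin (s + 1) g (Icc a b) t) ^ 2 := by
    intro i hi
    have hsub := Icc_subset_Icc (hxa i (by omega)) (hxb (i + 1) (by omega))
    obtain ⟨P, hP⟩ := aux_proj (k + 1) _ _ (hxlt i hi) w (hwd.continuousOn.mono hsub)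
    obtain ⟨Q, hQ⟩ := aux_proj k _ _ (hxlt i hi) u (hu.continuousOn.mono hsub)
    obtain ⟨q, hq⟩ := aux_sigma hab (hxa i (by omega)) (hxlt i hi) (hxb (i + 1) (by omega)) s k hs
      g hgd
    exact ⟨P, Q, q, hP, hQ, hq⟩
  choose! P Q q hP hQ hqd hqc hqe hqo hqerr using hex
  -- the test function
  have hDe : IsWeakDerivFam (k + 1) N x (fun i => u0 i - Q i) (fun i => un i - u (x i))
      (fun i => Du i - P i) := fun i hi =>
    aux_weak_sub (hDu i hi) (aux_weak hab (hxa i (by omega)) (hxlt i hi) (hxb (i + 1) (by omega)) k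
      u hu1 _ _ (hP i hi) (hQ i hi))
  have hed : ∀ i < N - 1, (u0 i - Q i).degree ≤ (k : WithBot ℕ) := fun i hi =>
    (Polynomial.degree_sub_le _ _).trans (max_le (hu0d i hi) (hQ i hi).1)
  have hv := hvar (fun i => u0 i - Q i) (fun i => un i - u (x i)) (fun i => Du i - P i)
    ⟨hed, by simp [hun0, hx0, hua]⟩ hDe
  have hload : ∀ i ∈ Finset.range (N - 1), ∫ t in x i..x (i + 1), f t * (u0 i - Q i).eval t
      = ((∫ t in x i..x (i + 1), (q i).eval t * (Du i - P i).eval t)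
        + ∫ t in x i..x (i + 1), a0 t * u t * (u0 i - Q i).eval t)
        - ((un (i + 1) - u (x (i + 1))) * g (x (i + 1)) - (un i - u (x i)) * g (x i)) := by
    intro i hi
    have hi := Finset.mem_range.1 hi
    exact aux_load (hxa i (by omega)) (hxlt i hi) (hxb (i + 1) (by omega)) k a0 f u g ha0c
      hu.continuousOn hg'c heq (q i) (hqd i hi) (hqc i hi) (hqe i hi) (hqo i hi) _ _ _ _
      (hed i hi) (hDe i hi)
  rw [Finset.sum_congr rfl hload, Finset.sum_sub_distrib, Finset.sum_add_distrib,
    Finset.sum_range_sub (fun i => (un i - u (x i)) * g (x i))] at hv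
  have hgb : g (x (N - 1)) = 0 := by simp [hg, hxN, hub]
  rw [hgb, hx0, hua, hun0] at hv
  set S : ℝ → ℝ := fun t => ∑ j ∈ Finset.range (s + 2 + 1),
    (iteratedDerivWithin j u (Icc a b) t) ^ 2 with hS
  have hjc : ∀ j ∈ Finset.range (s + 2 + 1),
      ContinuousOn (fun t => (iteratedDerivWithin j u (Icc a b) t) ^ 2) (Icc a b) := by
    intro j hj
    have hj' : j ≤ s + 2 := by simpa [Nat.lt_succ_iff] using hj
    exact (hu.continuousOn_iteratedDerivWithin (m := j) (by exact_mod_cast hj') hud).pow 2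
  have hSc : ContinuousOn S (Icc a b) := continuousOn_finsetSum _ hjc
  have hSj : ∀ j ∈ Finset.range (s + 2 + 1), ∀ t,
      (iteratedDerivWithin j u (Icc a b) t) ^ 2 ≤ S t := fun j hj t =>
    Finset.single_le_sum
      (f := fun j => (iteratedDerivWithin j u (Icc a b) t) ^ 2) (fun j _ => sq_nonneg _) hj
  have hsob : sobNorm (s + 2) a b u ^ 2 = ∫ t in a..b, S t := by
    rw [sobNorm, Real.sq_sqrt, hS, intervalIntegral.integral_finsetSum]
    · exact fun j hj => (hjc j hj).intervalIntegrable_of_Icc hab.le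
    · exact Finset.sum_nonneg fun j _ =>
        intervalIntegral.integral_nonneg hab.le fun t _ => sq_nonneg _
  have hsumS : ∑ i ∈ Finset.range (N - 1), ∫ t in x i..x (i + 1), S t = ∫ t in a..b, S t := by
    rw [intervalIntegral.sum_integral_adjacent_intervals, hx0, hxN]
    exact fun i hi => aux_ii (hxa i (by omega)) (hxlt i hi).le (hxb (i + 1) (by omega)) hSc
  have helem : ∀ i ∈ Finset.range (N - 1),
      ∫ t in x i..x (i + 1), ((Du i).eval t - w t) ^ 2 ≤
      (4 / amin) * ((∫ t in x i..x (i + 1), a2 t * (Du i).eval t * (Du i - P i).eval t)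
        + (∫ t in x i..x (i + 1), a0 t * (u0 i).eval t * (u0 i - Q i).eval t)
        - (∫ t in x i..x (i + 1), (q i).eval t * (Du i - P i).eval t)
        - (∫ t in x i..x (i + 1), a0 t * u t * (u0 i - Q i).eval t))
      + C2 * h ^ (2 * (s + 1)) * ∫ t in x i..x (i + 1), S t := by
    intro i hi
    have hi := Finset.mem_range.1 hi
    have hac := hxa i (by omega)
    have hdb := hxb (i + 1) (by omega)
    have hcd := hxlt i hi
    have hsub := Icc_subset_Icc hac hdb
    have e0 := aux_elem hamin hac hcd hdb a2 a0 u w M ha2.continuousOn ha0c hu.continuousOn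
      hwd.continuousOn ha2lb ha0nn ha2ub ha0ub (P i) (Q i) (q i) (Du i) (u0 i)
    have iS : IntervalIntegrable S volume (x i) (x (i + 1)) := aux_ii hac hcd.le hdb hSc
    have hpw : (x (i + 1) - x i) ^ (2 * (s + 1)) ≤ h ^ (2 * (s + 1)) :=
      pow_le_pow_left₀ (by linarith) (hh i hi) _
    have hbd : ∀ (F : ℝ → ℝ) (L E : ℝ), ContinuousOn F (Icc a b) → 0 ≤ L →
        (∀ t ∈ Icc a b, F t ^ 2 ≤ L * S t) →
        E ≤ (x (i + 1) - x i) ^ (2 * (s + 1)) * ∫ t in x i..x (i + 1), F t ^ 2 →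
        E ≤ h ^ (2 * (s + 1)) * (L * ∫ t in x i..x (i + 1), S t) := by
      intro F L E hF _ hFS hE
      refine hE.trans (mul_le_mul hpw ?_ ?_ (by positivity))
      · rw [← intervalIntegral.integral_const_mul]
        exact intervalIntegral.integral_mono_on hcd.le (aux_ii hac hcd.le hdb (hF.pow 2))
          (iS.const_mul _) fun t ht => hFS t (hsub ht)
      · exact intervalIntegral.integral_nonneg hcd.le fun t _ => sq_nonneg _
    have e1 := hbd _ K _ (hgd.continuousOn_iteratedDerivWithin (m := s + 1) (by simp) hud) hK0
      (fun t ht => hK u hu t ht) (hqerr i hi)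
    have e2 := hbd _ 1 _ (hwd.continuousOn_iteratedDerivWithin (m := s + 1) (by simp) hud)
      zero_le_one
      (fun t _ => by
        rw [one_mul, hw, ← iteratedDerivWithin_succ']
        exact hSj _ (Finset.mem_range.2 (by omega)) t)
      (aux_projerr hab hac hcd.le hdb (s + 1) (k + 1) (by omega) w
        (by exact_mod_cast hwd) (P i) (hP i hi))
    have e3 := hbd _ 1 _ (hus.continuousOn_iteratedDerivWithin (m := s + 1) (by simp) hud)
      zero_le_one
      (fun t _ => by
        rw [one_mul]
        exact hSj _ (Finset.mem_range.2 (by omega)) t)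
      (aux_projerr hab hac hcd.le hdb (s + 1) k (by omega) u hus (Q i) (hQ i hi))
    refine e0.trans ?_
    have f1 := mul_le_mul_of_nonneg_left e1 (by positivity : 0 ≤ 4 / amin ^ 2)
    have f2 := mul_le_mul_of_nonneg_left e2 (by positivity : 0 ≤ 4 * M ^ 2 / amin ^ 2 + 2)
    have f3 := mul_le_mul_of_nonneg_left e3 (by positivity : 0 ≤ 2 * M / amin)
    have e4 : C2 * h ^ (2 * (s + 1)) * (∫ t in x i..x (i + 1), S t)
        = 4 / amin ^ 2 * (h ^ (2 * (s + 1)) * (K * ∫ t in x i..x (i + 1), S t))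
        + (4 * M ^ 2 / amin ^ 2 + 2) * (h ^ (2 * (s + 1)) * (1 * ∫ t in x i..x (i + 1), S t))
        + 2 * M / amin * (h ^ (2 * (s + 1)) * (1 * ∫ t in x i..x (i + 1), S t)) := by
      rw [hC2]; ring
    rw [e4]
    linarith
  have htot := Finset.sum_le_sum helem
  rw [Finset.sum_add_distrib, ← Finset.mul_sum, ← Finset.mul_sum, hsumS, ← hsob,
    Finset.sum_sub_distrib, Finset.sum_sub_distrib, Finset.sum_add_distrib, hv] at htot
  refine Real.sqrt_le_iff.2 ⟨mul_nonneg (mul_nonneg (Real.sqrt_nonneg _) (by positivity))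
    (Real.sqrt_nonneg _), ?_⟩
  rw [mul_pow, mul_pow, Real.sq_sqrt hC2pos.le, ← pow_mul, mul_comm (s + 1) 2]
  refine htot.trans (le_of_eq ?_)
  ring
end
end

section
/- Let k ≥ 0 and r = k + 1, and suppose a_0 ≡ 0 and a_2 is (k+2)-times continuously differentiable with a_2(x) ≥ a_min > 0 on [a,b]. There exists a constant C > 0, independent of the partition, such that for every partition a = x_1 < … < x_N = b, if u is (k+3)-times continuously differentiable on [a,b], solves −(a_2 u′)′ = f on (a,b) with u(a) = 0, u′(b) = 0, and u_h ∈ S_h is the weak finite element solution, then the superconvergence estimate ‖d_{w,r}u_h − u′‖_h ≤ C h^{k+2} ‖u‖_{k+3} holds. -/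
open MeasureTheory Set

noncomputable section

open Polynomial in
lemma poly_prim (p : ℝ[X]) (l : ℕ) (hp : p.degree ≤ (l : WithBot ℕ)) (c v : ℝ) :
    ∃ P : ℝ[X], P.degree ≤ ((l + 1 : ℕ) : WithBot ℕ) ∧ derivative P = p ∧ P.eval c = v := by
  let Q : ℝ[X] := ∑ i ∈ Finset.range (l + 1), monomial (i + 1) (p.coeff i / ((i : ℝ) + 1))
  have hQd : Q.degree ≤ ((l + 1 : ℕ) : WithBot ℕ) := by
    refine mem_degreeLE.1 (Submodule.sum_mem _ fun i hi => mem_degreeLE.2 ?_)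
    refine (degree_monomial_le _ _).trans ?_
    have := Finset.mem_range.1 hi
    exact_mod_cast this
  have hQ : derivative Q = p := by
    have hp' : p.natDegree < l + 1 := Nat.lt_succ_of_le (natDegree_le_iff_degree_le.2 hp)
    conv_rhs => rw [as_sum_range' p (l + 1) hp']
    simp only [Q, derivative_sum]
    refine Finset.sum_congr rfl fun i _ => ?_
    rw [derivative_monomial]
    have : (i : ℝ) + 1 ≠ 0 := by positivity
    congr 1
    push_cast
    field_simp
  refine ⟨Q + C (v - Q.eval c), ?_, by simp [hQ], by simp⟩
  refine (degree_add_le _ _).trans (max_le hQd (degree_C_le.trans ?_))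
  exact_mod_cast Nat.zero_le _

open Polynomial in
lemma poly_zero_of_integral (c d : ℝ) (hcd : c < d) (p : ℝ[X])
    (h : ∫ t in c..d, p.eval t * p.eval t = 0) : p = 0 := by
  have h0 : ∀ t ∈ Ioo c d, p.eval t = 0 := by
    by_contra! hne
    obtain ⟨t, ht, hne⟩ := hne
    have : 0 < ∫ t in c..d, p.eval t * p.eval t :=
      intervalIntegral.integral_pos hcd (by fun_prop) (fun t _ => mul_self_nonneg _)
        ⟨t, Ioo_subset_Icc_self ht, mul_self_pos.2 hne⟩
    linarith
  exact Polynomial.eq_zero_of_infinite_isRoot p ((Ioo_infinite hcd).mono fun t ht => h0 t ht)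

open Polynomial in
lemma poly_riesz (c d : ℝ) (hcd : c < d) (l : ℕ) (φ : ℝ[X] →ₗ[ℝ] ℝ) :
    ∃ p : ℝ[X], p.degree ≤ (l : WithBot ℕ) ∧ ∀ q : ℝ[X], q.degree ≤ (l : WithBot ℕ) →
      ∫ t in c..d, p.eval t * q.eval t = φ q := by
  have hintg : ∀ p q : ℝ[X], IntervalIntegrable (fun t => p.eval t * q.eval t) volume c d :=
    fun p q => (by fun_prop : Continuous fun t => p.eval t * q.eval t).intervalIntegrable _ _
  let B : ℝ[X] →ₗ[ℝ] ℝ[X] →ₗ[ℝ] ℝ := LinearMap.mk₂ ℝ (fun p q => ∫ t in c..d, p.eval t * q.eval t)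
    (fun p p' q => by
      simp only [eval_add, add_mul]
      rw [intervalIntegral.integral_add (hintg _ _) (hintg _ _)])
    (fun r p q => by
      simp only [eval_smul, smul_eq_mul, mul_assoc]
      rw [intervalIntegral.integral_const_mul])
    (fun p q q' => by
      simp only [eval_add, mul_add]
      rw [intervalIntegral.integral_add (hintg _ _) (hintg _ _)])
    (fun r p q => by
      simp only [eval_smul, smul_eq_mul, mul_left_comm _ r]
      rw [intervalIntegral.integral_const_mul])
  let W := degreeLT ℝ (l + 1)
  have hW : ∀ p : ℝ[X], p ∈ W ↔ p.degree ≤ (l : WithBot ℕ) := fun p => by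
    rw [mem_degreeLT, degree_le_iff_coeff_zero, degree_lt_iff_coeff_zero]
    constructor
    · intro h m hm
      exact h m (by exact_mod_cast hm)
    · intro h m hm
      exact h m (by exact_mod_cast hm)
  have : FiniteDimensional ℝ W := (degreeLTEquiv ℝ (l + 1)).symm.finiteDimensional
  let T : W →ₗ[ℝ] Module.Dual ℝ W := B.domRestrict₁₂ W W
  have hinj : Function.Injective T := by
    rw [← LinearMap.ker_eq_bot, LinearMap.ker_eq_bot']
    intro p hp
    have : T p p = 0 := by rw [hp]; rfl
    exact Subtype.ext (poly_zero_of_integral c d hcd p this)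
  have hsurj : Function.Surjective T :=
    (LinearMap.injective_iff_surjective_of_finrank_eq_finrank
      (Subspace.dual_finrank_eq (K := ℝ) (V := W)).symm).1 hinj
  obtain ⟨p, hp⟩ := hsurj (φ.domRestrict W)
  refine ⟨p, (hW _).1 p.2, fun q hq => ?_⟩
  have := congrArg (fun g => g ⟨q, (hW q).2 hq⟩) hp
  exact this

lemma cs_one (c d : ℝ) (hcd : c ≤ d) (G : ℝ → ℝ) (hG : ContinuousOn G (Icc c d)) :
    (∫ t in c..d, G t) ^ 2 ≤ (d - c) * ∫ t in c..d, G t ^ 2 := by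
  have hG' : ContinuousOn G (uIcc c d) := by rwa [uIcc_of_le hcd]
  rcases hcd.eq_or_lt with rfl | hlt
  · simp
  set m := (∫ t in c..d, G t) / (d - c) with hm
  have h0 : 0 ≤ ∫ t in c..d, (G t - m) ^ 2 :=
    intervalIntegral.integral_nonneg hcd fun t _ => sq_nonneg _
  have h1 : ∫ t in c..d, (G t - m) ^ 2
      = (∫ t in c..d, G t ^ 2) - 2 * m * (∫ t in c..d, G t) + (d - c) * m ^ 2 := by
    have : ∀ t, (G t - m) ^ 2 = (G t ^ 2 - (2 * m) * G t) + m ^ 2 := fun t => by ring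
    simp only [this]
    rw [intervalIntegral.integral_add, intervalIntegral.integral_sub,
      intervalIntegral.integral_const_mul, intervalIntegral.integral_const, smul_eq_mul]
    all_goals apply ContinuousOn.intervalIntegrable; fun_prop
  have hd : 0 < d - c := sub_pos.2 hlt
  have h2 : (∫ t in c..d, G t) = m * (d - c) := by rw [hm]; field_simp
  rw [h1, h2] at h0
  rw [h2]
  nlinarith

lemma poincare (c d : ℝ) (hcd : c ≤ d) (F G : ℝ → ℝ) (hF : ContinuousOn F (Icc c d))
    (hG : ContinuousOn G (Icc c d)) (hFG : ∀ t ∈ Ioo c d, HasDerivAt F (G t) t) (hFc : F c = 0) :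
    ∫ t in c..d, F t ^ 2 ≤ (d - c) ^ 2 * ∫ t in c..d, G t ^ 2 := by
  have hG2 : IntervalIntegrable (fun t => G t ^ 2) volume c d := by
    apply ContinuousOn.intervalIntegrable
    rw [uIcc_of_le hcd]; fun_prop
  have hpt : ∀ t ∈ Icc c d, F t ^ 2 ≤ (d - c) * ∫ s in c..d, G s ^ 2 := by
    intro t ht
    have hsub : Icc c t ⊆ Icc c d := Icc_subset_Icc_right ht.2
    have hFt : ∫ s in c..t, G s = F t := by
      rw [intervalIntegral.integral_eq_sub_of_hasDerivAt_of_le ht.1 (hF.mono hsub)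
        (fun s hs => hFG s ⟨hs.1, hs.2.trans_le ht.2⟩), hFc, sub_zero]
      apply ContinuousOn.intervalIntegrable
      rw [uIcc_of_le ht.1]; exact hG.mono hsub
    rw [← hFt]
    refine (cs_one c t ht.1 G (hG.mono hsub)).trans ?_
    have hnn : 0 ≤ ∫ s in c..t, G s ^ 2 :=
      intervalIntegral.integral_nonneg ht.1 fun t _ => sq_nonneg _
    have hle : ∫ s in c..t, G s ^ 2 ≤ ∫ s in c..d, G s ^ 2 :=
      intervalIntegral.integral_mono_interval le_rfl ht.1 ht.2
        (Filter.Eventually.of_forall fun s => sq_nonneg _) hG2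
    have := ht.2
    have := ht.1
    gcongr
  calc ∫ t in c..d, F t ^ 2 ≤ ∫ t in c..d, (d - c) * ∫ s in c..d, G s ^ 2 := by
        apply intervalIntegral.integral_mono_on hcd _ _ hpt
        · apply ContinuousOn.intervalIntegrable
          rw [uIcc_of_le hcd]; fun_prop
        · simp
    _ = _ := by rw [intervalIntegral.integral_const, smul_eq_mul]; ring

lemma hasDerivAt_of_cd {a b : ℝ} {g : ℝ → ℝ} {n : ℕ} (hn : 1 ≤ n)
    (hg : ContDiffOn ℝ n g (Icc a b)) {t : ℝ} (ht : t ∈ Ioo a b) :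
    HasDerivAt g (derivWithin g (Icc a b) t) t :=
  ((hg.differentiableOn (by exact_mod_cast (by omega : n ≠ 0))) t
    (Ioo_subset_Icc_self ht)).hasDerivWithinAt.hasDerivAt (Icc_mem_nhds ht.1 ht.2)

open Polynomial in
lemma approx_key (a b : ℝ) (hab : a < b) (g : ℝ → ℝ) (n : ℕ)
    (hg : ContDiffOn ℝ ((n + 1 : ℕ) : WithTop ℕ∞) g (Icc a b))
    (c d : ℝ) (hac : a ≤ c) (hcd : c ≤ d) (hdb : d ≤ b) (P : ℝ[X]) (hP : P.eval c = g c) :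
    ∫ t in c..d, (g t - P.eval t) ^ 2 ≤ (d - c) ^ 2 *
      ∫ t in c..d, (derivWithin g (Icc a b) t - (derivative P).eval t) ^ 2 := by
  have hsub : Icc c d ⊆ Icc a b := Icc_subset_Icc hac hdb
  refine poincare c d hcd (fun t => g t - P.eval t) _ ?_ ?_ ?_ (by simp [hP])
  · exact (hg.continuousOn.mono hsub).sub (by fun_prop)
  · refine ContinuousOn.sub ?_ (by fun_prop)
    exact (hg.continuousOn_derivWithin (uniqueDiffOn_Icc hab) (by simp)).mono hsub
  · intro t ht
    exact (hasDerivAt_of_cd (by omega) hg ⟨hac.trans_lt ht.1, ht.2.trans_le hdb⟩).sub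
      (P.hasDerivAt t)

open Polynomial in
lemma approx (a b : ℝ) (hab : a < b) (m : ℕ) : ∀ (g : ℝ → ℝ), 
    ContDiffOn ℝ ((m + 1 : ℕ) : WithTop ℕ∞) g (Icc a b) → ∀ c d : ℝ, a ≤ c → c ≤ d → d ≤ b →
    ∃ p : ℝ[X], p.degree ≤ (m : WithBot ℕ) ∧
      ∫ t in c..d, (g t - p.eval t) ^ 2 ≤
        (d - c) ^ (2 * (m + 1)) *
          ∫ t in c..d, (iteratedDerivWithin (m + 1) g (Icc a b) t) ^ 2 := by
  induction m with
  | zero =>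
    intro g hg c d hac hcd hdb
    refine ⟨C (g c), degree_C_le, ?_⟩
    have := approx_key a b hab g 0 hg c d hac hcd hdb (C (g c)) (by simp)
    simpa [iteratedDerivWithin_one] using this
  | succ m ih =>
    intro g hg c d hac hcd hdb
    obtain ⟨p, hp, hpe⟩ := ih (derivWithin g (Icc a b))
      (hg.derivWithin (uniqueDiffOn_Icc hab) (by norm_cast)) c d hac hcd hdb
    obtain ⟨P, hP, hPd, hPc⟩ := poly_prim p m hp c (g c)
    refine ⟨P, hP, (approx_key a b hab g _ hg c d hac hcd hdb P hPc).trans ?_⟩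
    rw [hPd]
    refine (mul_le_mul_of_nonneg_left hpe (sq_nonneg _)).trans (le_of_eq ?_)
    rw [← mul_assoc, ← pow_add]
    congr 1
    · congr 1; ring
    · simp only [iteratedDerivWithin_succ' (n := m + 1)]

open Polynomial in
lemma deriv_deg {q : ℝ[X]} {k : ℕ} (hq : q.degree ≤ ((k + 1 : ℕ) : WithBot ℕ)) :
    (derivative q).degree ≤ (k : WithBot ℕ) := by
  rw [← natDegree_le_iff_degree_le] at hq ⊢
  exact (natDegree_derivative_le q).trans (by omega)

open Polynomial in
lemma poly_ibp (P q : ℝ[X]) (c d : ℝ) :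
    ∫ t in c..d, (derivative P).eval t * q.eval t =
      -(∫ t in c..d, P.eval t * (derivative q).eval t) + P.eval d * q.eval d
        - P.eval c * q.eval c := by
  have h := intervalIntegral.integral_mul_deriv_eq_deriv_mul (a := c) (b := d)
    (u := fun t => q.eval t) (v := fun t => P.eval t)
    (fun t _ => q.hasDerivAt t) (fun t _ => P.hasDerivAt t)
    ((by fun_prop : Continuous fun t => (derivative q).eval t).intervalIntegrable _ _)
    ((by fun_prop : Continuous fun t => (derivative P).eval t).intervalIntegrable _ _)
  simp only [mul_comm (eval _ q), mul_comm (eval _ (derivative q))] at h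
  rw [h]; ring

open Polynomial in
/-- the functional `q ↦ ∫ g q`. -/
lemma exists_proj (c d : ℝ) (hcd : c < d) (l : ℕ) (g : ℝ → ℝ) (hg : ContinuousOn g (Icc c d)) :
    ∃ p : ℝ[X], p.degree ≤ (l : WithBot ℕ) ∧ ∀ q : ℝ[X], q.degree ≤ (l : WithBot ℕ) →
      ∫ t in c..d, p.eval t * q.eval t = ∫ t in c..d, g t * q.eval t := by
  have hintg : ∀ q : ℝ[X], IntervalIntegrable (fun t => g t * q.eval t) volume c d := fun q => by
    apply ContinuousOn.intervalIntegrable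
    rw [uIcc_of_le hcd.le]
    exact hg.mul (by fun_prop)
  exact poly_riesz c d hcd l
    { toFun := fun q => ∫ t in c..d, g t * q.eval t
      map_add' := fun q q' => by
        simp only [eval_add, mul_add]
        rw [intervalIntegral.integral_add (hintg _) (hintg _)]
      map_smul' := fun r q => by
        simp only [eval_smul, smul_eq_mul, mul_left_comm _ r, RingHom.id_apply]
        rw [intervalIntegral.integral_const_mul] }

open Polynomial in
lemma proj_best (c d : ℝ) (hcd : c < d) (l : ℕ) (g : ℝ → ℝ) (hg : ContinuousOn g (Icc c d))
    (p : ℝ[X]) (hp : p.degree ≤ (l : WithBot ℕ))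
    (h : ∀ q : ℝ[X], q.degree ≤ (l : WithBot ℕ) →
      ∫ t in c..d, p.eval t * q.eval t = ∫ t in c..d, g t * q.eval t)
    (p₂ : ℝ[X]) (hp₂ : p₂.degree ≤ (l : WithBot ℕ)) :
    ∫ t in c..d, (g t - p.eval t) ^ 2 ≤ ∫ t in c..d, (g t - p₂.eval t) ^ 2 := by
  have hg' : ContinuousOn g (uIcc c d) := by rwa [uIcc_of_le hcd.le]
  have h0 := h (p - p₂) ((degree_sub_le _ _).trans (max_le hp hp₂))
  have e : ∀ t, (g t - p₂.eval t) ^ 2 = ((g t - p.eval t) ^ 2 +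
      2 * (g t * (p - p₂).eval t - p.eval t * (p - p₂).eval t)) + ((p - p₂).eval t) ^ 2 := by
    intro t; simp only [eval_sub]; ring
  simp only [e]
  have hi1 : IntervalIntegrable (fun t => (g t - p.eval t) ^ 2) volume c d := by
    apply ContinuousOn.intervalIntegrable; fun_prop
  have hi2 : IntervalIntegrable (fun t => g t * (p - p₂).eval t) volume c d := by
    apply ContinuousOn.intervalIntegrable; fun_prop
  have hi3 : IntervalIntegrable (fun t => p.eval t * (p - p₂).eval t) volume c d := by
    apply ContinuousOn.intervalIntegrable; fun_prop
  have hi4 : IntervalIntegrable (fun t => ((p - p₂).eval t) ^ 2) volume c d := by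
    apply ContinuousOn.intervalIntegrable; fun_prop
  rw [intervalIntegral.integral_add (hi1.add ((hi2.sub hi3).const_mul 2)) hi4,
    intervalIntegral.integral_add hi1 ((hi2.sub hi3).const_mul 2),
    intervalIntegral.integral_const_mul, intervalIntegral.integral_sub hi2 hi3, h0]
  have : 0 ≤ ∫ t in c..d, ((p - p₂).eval t) ^ 2 :=
    intervalIntegral.integral_nonneg hcd.le fun t _ => sq_nonneg _
  linarith

open Polynomial in
lemma interp (a b : ℝ) (hab : a < b) (k : ℕ) (σ : ℝ → ℝ)
    (hσ : ContDiffOn ℝ ((k + 2 : ℕ) : WithTop ℕ∞) σ (Icc a b)) (c d : ℝ) (hac : a ≤ c)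
    (hcd : c < d) (hdb : d ≤ b) :
    ∃ τ : ℝ[X], τ.degree ≤ ((k + 1 : ℕ) : WithBot ℕ) ∧ τ.eval c = σ c ∧ τ.eval d = σ d ∧
      (∀ q : ℝ[X], q.degree ≤ (k : WithBot ℕ) →
        ∫ t in c..d, (derivative τ).eval t * q.eval t
          = ∫ t in c..d, derivWithin σ (Icc a b) t * q.eval t) ∧
      ∫ t in c..d, (σ t - τ.eval t) ^ 2 ≤ (d - c) ^ (2 * (k + 2)) *
          ∫ t in c..d, (iteratedDerivWithin (k + 2) σ (Icc a b) t) ^ 2 := by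
  have hsub : Icc c d ⊆ Icc a b := Icc_subset_Icc hac hdb
  have hc' : ContDiffOn ℝ ((k + 1 : ℕ) : WithTop ℕ∞) (derivWithin σ (Icc a b)) (Icc a b) :=
    hσ.derivWithin (uniqueDiffOn_Icc hab) (by norm_cast)
  have hcont : ContinuousOn (derivWithin σ (Icc a b)) (Icc c d) := hc'.continuousOn.mono hsub
  obtain ⟨p, hp, hpp⟩ := exists_proj c d hcd k _ hcont
  obtain ⟨τ, hτ, hτd, hτc⟩ := poly_prim p k hp c (σ c)
  obtain ⟨p₂, hp₂, hp₂e⟩ := approx a b hab k _ hc' c d hac hcd.le hdb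
  refine ⟨τ, hτ, hτc, ?_, ?_, ?_⟩
  · have h1 := hpp 1 (degree_one_le.trans (by exact_mod_cast Nat.zero_le _))
    simp only [eval_one, mul_one] at h1
    rw [← hτd, intervalIntegral.integral_eq_sub_of_hasDerivAt (f := fun t => τ.eval t)
        (fun t _ => τ.hasDerivAt t)
        ((by fun_prop : Continuous fun t => (derivative τ).eval t).intervalIntegrable _ _),
      intervalIntegral.integral_eq_sub_of_hasDerivAt_of_le hcd.le (hσ.continuousOn.mono hsub)
        (fun t ht => hasDerivAt_of_cd (by omega) hσ ⟨hac.trans_lt ht.1, ht.2.trans_le hdb⟩)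
        (by apply ContinuousOn.intervalIntegrable; rwa [uIcc_of_le hcd.le]), hτc] at h1
    linarith
  · rw [hτd]; exact hpp
  · refine (approx_key a b hab σ (k + 1) hσ c d hac hcd.le hdb τ hτc).trans ?_
    rw [hτd]
    refine (mul_le_mul_of_nonneg_left ((proj_best c d hcd k _ hcont p hp hpp p₂ hp₂).trans hp₂e)
      (sq_nonneg _)).trans (le_of_eq ?_)
    rw [← mul_assoc, ← pow_add]
    congr 1
    · congr 1; ring
    · simp only [iteratedDerivWithin_succ' (n := k + 1)]

lemma leibniz_bound (a b : ℝ) (hab : a < b) (n : ℕ) (g : ℝ → ℝ)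
    (hg : ContDiffOn ℝ (n : WithTop ℕ∞) g (Icc a b)) :
    ∃ K : ℝ, 0 ≤ K ∧ ∀ w : ℝ → ℝ, ContDiffOn ℝ (n : WithTop ℕ∞) w (Icc a b) → ∀ t ∈ Icc a b,
      (iteratedDerivWithin n (fun s => g s * w s) (Icc a b) t) ^ 2 ≤
        K * ∑ j ∈ Finset.range (n + 1), (iteratedDerivWithin j w (Icc a b) t) ^ 2 := by
  have hu := uniqueDiffOn_Icc hab
  have hb : ∀ j, ∃ M : ℝ, j ≤ n → ∀ t ∈ Icc a b, |iteratedDerivWithin j g (Icc a b) t| ≤ M := by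
    intro j
    by_cases hj : j ≤ n
    · obtain ⟨M, hM⟩ := isCompact_Icc.exists_bound_of_continuousOn
        (hg.continuousOn_iteratedDerivWithin (m := j) (by exact_mod_cast hj) hu)
      exact ⟨M, fun _ t ht => hM t ht⟩
    · exact ⟨0, fun h => absurd h hj⟩
  choose M hM using hb
  refine ⟨∑ i ∈ Finset.range (n + 1), ((n.choose i : ℝ) * M i) ^ 2,
    Finset.sum_nonneg fun _ _ => sq_nonneg _, fun w hw t ht => ?_⟩
  have h1 := norm_iteratedFDerivWithin_mul_le hg hw hu ht (n := n) le_rfl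
  simp only [norm_iteratedFDerivWithin_eq_norm_iteratedDerivWithin, Real.norm_eq_abs] at h1
  have h2 : |iteratedDerivWithin n (fun s => g s * w s) (Icc a b) t| ≤
      ∑ i ∈ Finset.range (n + 1), ((n.choose i : ℝ) * M i) *
        |iteratedDerivWithin (n - i) w (Icc a b) t| := by
    refine h1.trans (Finset.sum_le_sum fun i hi => ?_)
    have := hM i (Nat.lt_succ_iff.1 (Finset.mem_range.1 hi)) t ht
    gcongr
  rw [← sq_abs]
  refine (pow_le_pow_left₀ (abs_nonneg _) h2 2).trans ((Finset.sum_mul_sq_le_sq_mul_sq _ _ _).trans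
    (le_of_eq ?_))
  congr 1
  simp only [sq_abs]
  rw [← Finset.sum_range_reflect (fun j => (iteratedDerivWithin j w (Icc a b) t) ^ 2)]
  simp

open Polynomial in
lemma orthogonality (k n : ℕ) (a b : ℝ) (hab : a < b) (x : ℕ → ℝ) (a2 f σ : ℝ → ℝ)
    (hx0 : x 0 = a) (hxn : x n = b) (hx : ∀ i < n, x i < x (i + 1))
    (hxa : ∀ i < n, a ≤ x i) (hxb : ∀ i < n, x (i + 1) ≤ b)
    (hf : ∀ t ∈ Ioo a b, f t = -derivWithin σ (Icc a b) t) (hσb : σ b = 0)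
    (τ : ℕ → ℝ[X]) (hτ : ∀ i < n, (τ i).degree ≤ ((k + 1 : ℕ) : WithBot ℕ))
    (hτl : ∀ i < n, (τ i).eval (x i) = σ (x i))
    (hτr : ∀ i < n, (τ i).eval (x (i + 1)) = σ (x (i + 1)))
    (hτo : ∀ i < n, ∀ q : ℝ[X], q.degree ≤ (k : WithBot ℕ) →
      ∫ t in x i..x (i + 1), (derivative (τ i)).eval t * q.eval t
        = ∫ t in x i..x (i + 1), derivWithin σ (Icc a b) t * q.eval t)
    (u0 : ℕ → ℝ[X]) (un : ℕ → ℝ) (Du : ℕ → ℝ[X])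
    (hsol : IsWFESol k (k + 1) (n + 1) x a2 (fun _ => 0) f u0 un Du)
    (w : ℕ → ℝ[X]) (hw : ∀ i < n, (w i).degree ≤ ((k + 1 : ℕ) : WithBot ℕ)) :
    ∑ i ∈ Finset.range n, ∫ t in x i..x (i + 1), a2 t * (Du i).eval t * (w i).eval t
      = ∑ i ∈ Finset.range n, ∫ t in x i..x (i + 1), (τ i).eval t * (w i).eval t := by
  have hex : ∀ (i : ℕ) (v : ℝ), ∃ P : ℝ[X], i < n → derivative P = w i ∧ P.eval (x i) = v := by
    intro i v
    by_cases hi : i < n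
    · obtain ⟨P, -, h1, h2⟩ := poly_prim (w i) (k + 1) (hw i hi) (x i) v
      exact ⟨P, fun _ => ⟨h1, h2⟩⟩
    · exact ⟨0, fun h => absurd h hi⟩
  choose PR hPR using hex
  let vn : ℕ → ℝ := fun i => Nat.rec 0 (fun i v => (PR i v).eval (x (i + 1))) i
  let V : ℕ → ℝ[X] := fun i => PR i (vn i)
  have hVd : ∀ i < n, derivative (V i) = w i := fun i hi => (hPR i (vn i) hi).1
  have hVl : ∀ i < n, (V i).eval (x i) = vn i := fun i hi => (hPR i (vn i) hi).2
  have hVr : ∀ i, (V i).eval (x (i + 1)) = vn (i + 1) := fun i => rfl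
  have hv0 : ∀ i, ∃ p : ℝ[X], i < n → p.degree ≤ (k : WithBot ℕ) ∧
      ∀ q : ℝ[X], q.degree ≤ (k : WithBot ℕ) →
      ∫ t in x i..x (i + 1), p.eval t * q.eval t
        = ∫ t in x i..x (i + 1), (V i).eval t * q.eval t := by
    intro i
    by_cases hi : i < n
    · obtain ⟨p, h⟩ := exists_proj (x i) (x (i + 1)) (hx i hi) k (fun t => (V i).eval t)
        (by fun_prop)
      exact ⟨p, fun _ => h⟩
    · exact ⟨0, fun h => absurd h hi⟩
  choose v0 hv0 using hv0
  have hmain := hsol.2.2 v0 vn w ⟨fun i hi => (hv0 i hi).1, rfl⟩ (by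
    intro i hi
    refine ⟨hw i hi, fun q hq => ?_⟩
    rw [(hv0 i hi).2 _ (deriv_deg hq), ← hVd i hi, poly_ibp, hVl i hi, hVr i])
  simp only [Nat.add_sub_cancel, zero_mul, intervalIntegral.integral_zero, Finset.sum_const_zero,
    add_zero] at hmain
  rw [hmain]
  have hloc : ∀ i < n, ∫ t in x i..x (i + 1), f t * (v0 i).eval t =
      (∫ t in x i..x (i + 1), (τ i).eval t * (w i).eval t)
        - (vn (i + 1) * σ (x (i + 1)) - vn i * σ (x i)) := by
    intro i hi
    have e1 : ∫ t in x i..x (i + 1), f t * (v0 i).eval t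
        = ∫ t in x i..x (i + 1), -(derivWithin σ (Icc a b) t * (v0 i).eval t) := by
      rw [intervalIntegral.integral_of_le (hx i hi).le, intervalIntegral.integral_of_le (hx i hi).le,
        integral_Ioc_eq_integral_Ioo, integral_Ioc_eq_integral_Ioo]
      refine setIntegral_congr_fun measurableSet_Ioo fun t ht => ?_
      change f t * (v0 i).eval t = -(derivWithin σ (Icc a b) t * (v0 i).eval t)
      rw [hf t ⟨(hxa i hi).trans_lt ht.1, ht.2.trans_le (hxb i hi)⟩]
      ring
    rw [e1, intervalIntegral.integral_neg, ← hτo i hi _ (hv0 i hi).1]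
    have e2 := (hv0 i hi).2 _ (deriv_deg (hτ i hi))
    have e3 := poly_ibp (V i) (τ i) (x i) (x (i + 1))
    rw [hVd i hi, hVl i hi, hVr i, hτl i hi, hτr i hi] at e3
    simp only [mul_comm (eval _ (derivative (τ i)))]
    rw [e2]
    simp only [mul_comm (eval _ (τ i))]
    rw [e3]; ring
  rw [Finset.sum_congr rfl fun i hi => hloc i (Finset.mem_range.1 hi), Finset.sum_sub_distrib,
    Finset.sum_range_sub (fun i => vn i * σ (x i)), hxn, hσb]
  have : vn 0 = 0 := rfl
  rw [this]; ring

lemma pointwise_bound (amin M A D p w s τ : ℝ) (hamin : 0 < amin) (h1 : amin ≤ A) (h2 : |A| ≤ M)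
    (hs : s = A * w) :
    (D - w) ^ 2 ≤ 4 / amin * (A * D * (D - p) - τ * (D - p))
      + (2 + 4 * M ^ 2 / amin ^ 2) * (w - p) ^ 2 + 4 / amin ^ 2 * (s - τ) ^ 2 := by
  subst hs
  have hA : A ^ 2 ≤ M ^ 2 := by rw [← sq_abs]; exact pow_le_pow_left₀ (abs_nonneg _) h2 2
  have q1 : (D - w) ^ 2 ≤ 2 * (D - p) ^ 2 + 2 * (w - p) ^ 2 := by
    nlinarith [sq_nonneg (D - p + (w - p))]
  have q2 : (A * p - τ) ^ 2 ≤ 2 * M ^ 2 * (w - p) ^ 2 + 2 * (A * w - τ) ^ 2 := by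
    have : A ^ 2 * (w - p) ^ 2 ≤ M ^ 2 * (w - p) ^ 2 := by gcongr
    nlinarith [sq_nonneg (A * (w - p) + (A * w - τ))]
  have q3 : amin ^ 2 * (D - p) ^ 2 ≤ 2 * amin * (A * D * (D - p) - τ * (D - p))
      + (A * p - τ) ^ 2 := by
    have : amin * (amin * (D - p) ^ 2) ≤ amin * (A * (D - p) ^ 2) := by gcongr
    nlinarith [sq_nonneg (amin * (D - p) + (A * p - τ))]
  have q4 : (D - p) ^ 2 ≤ (2 * amin * (A * D * (D - p) - τ * (D - p))
      + (2 * M ^ 2 * (w - p) ^ 2 + 2 * (A * w - τ) ^ 2)) / amin ^ 2 := by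
    rw [le_div_iff₀ (by positivity)]
    linarith
  refine q1.trans (le_trans (add_le_add_left (mul_le_mul_of_nonneg_left q4 zero_le_two) _)
    (le_of_eq ?_))
  field_simp
  ring

/-- Theorem 4.4, superconvergence (4.18). Let `k ≥ 0`, `r = k + 1`,
`a0 ≡ 0`, and `a2 ∈ C^{k+2}([a,b])` with `a2 ≥ a_min > 0`. There is a constant `C > 0`
independent of the partition such that for every partition with mesh size `h`, if
`u ∈ C^{k+3}([a,b])` solves `-(a2 u')' = f` on `(a,b)` with `u(a) = 0`, `u'(b) = 0`, and
`u_h ∈ S_h` is the weak finite element solution, then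
`‖d_{w,r}u_h − u'‖_h ≤ C h^{k+2} ‖u‖_{k+3}`. -/
theorem superconvergence_H1 (k : ℕ) (a b amin : ℝ) (hab : a < b) (hamin : 0 < amin)
    (a2 : ℝ → ℝ)
    (ha2 : ContDiffOn ℝ (k + 2) a2 (Set.Icc a b)) (ha2lb : ∀ t ∈ Set.Icc a b, amin ≤ a2 t) :
    ∃ C > (0 : ℝ), ∀ (N : ℕ) (x : ℕ → ℝ), IsPartition N a b x →
      ∀ h : ℝ, (∀ i < N - 1, x (i + 1) - x i ≤ h) →
      ∀ f u : ℝ → ℝ, ContDiffOn ℝ (k + 3) u (Set.Icc a b) →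
        SolvesBVP a b a2 (fun _ => 0) f u →
      ∀ (u0 : ℕ → Polynomial ℝ) (un : ℕ → ℝ) (Du : ℕ → Polynomial ℝ),
        IsWFESol k (k + 1) N x a2 (fun _ => 0) f u0 un Du →
        Real.sqrt (∑ i ∈ Finset.range (N - 1),
            ∫ t in x i..x (i + 1), ((Du i).eval t - derivWithin u (Set.Icc a b) t) ^ 2)
          ≤ C * h ^ (k + 2) * sobNorm (k + 3) a b u := by
  have hu := uniqueDiffOn_Icc hab
  have ha2' : ContDiffOn ℝ ((k + 2 : ℕ) : WithTop ℕ∞) a2 (Icc a b) := by exact_mod_cast ha2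
  obtain ⟨M, hM⟩ := isCompact_Icc.exists_bound_of_continuousOn ha2.continuousOn
  obtain ⟨K, hK0, hK⟩ := leibniz_bound a b hab (k + 2) a2 ha2'
  set K1 : ℝ := 2 + 4 * M ^ 2 / amin ^ 2 with hK1
  set K2 : ℝ := 4 / amin ^ 2 with hK2
  have hK1p : 0 < K1 := by positivity
  have hK2p : 0 < K2 := by positivity
  refine ⟨Real.sqrt (K1 + K2 * K), Real.sqrt_pos.2 (by positivity), ?_⟩
  intro N x hpart h hh f u hucd hbvp u0 un Du hsol
  obtain ⟨hN, hx0, hxn, hx⟩ := hpart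
  obtain ⟨n, rfl⟩ : ∃ n, N = n + 1 := ⟨N - 1, by omega⟩
  simp only [Nat.add_sub_cancel] at hxn hx hh ⊢
  have hmono : ∀ j ≤ n, ∀ i ≤ j, x i ≤ x j := by
    intro j
    induction j with
    | zero => intro _ i hi; rw [Nat.le_zero.1 hi]
    | succ j ih =>
      intro hj i hi
      rcases Nat.le_succ_iff.1 hi with h' | h'
      · exact (ih (by omega) i h').trans (hx j (by omega)).le
      · rw [h']
  have hxa : ∀ i < n, a ≤ x i := fun i hi => hx0 ▸ hmono i hi.le 0 (Nat.zero_le _)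
  have hxb : ∀ i < n, x (i + 1) ≤ b := fun i hi => hxn ▸ hmono n le_rfl (i + 1) hi
  have hsub : ∀ i < n, Icc (x i) (x (i + 1)) ⊆ Icc a b := fun i hi =>
    Icc_subset_Icc (hxa i hi) (hxb i hi)
  set w : ℝ → ℝ := derivWithin u (Icc a b) with hw
  have hucd' : ContDiffOn ℝ ((k + 3 : ℕ) : WithTop ℕ∞) u (Icc a b) := by exact_mod_cast hucd
  have hwcd : ContDiffOn ℝ ((k + 2 : ℕ) : WithTop ℕ∞) w (Icc a b) :=
    hucd'.derivWithin hu (by norm_cast)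
  set σ : ℝ → ℝ := fun t => a2 t * w t with hσ
  have hσcd : ContDiffOn ℝ ((k + 2 : ℕ) : WithTop ℕ∞) σ (Icc a b) := ha2'.mul hwcd
  obtain ⟨hode, -, hub⟩ := hbvp
  -- local approximations
  have hτ : ∀ i, ∃ τ : Polynomial ℝ, i < n → _ := fun i => by
    by_cases hi : i < n
    · obtain ⟨τ, h'⟩ := interp a b hab k σ hσcd (x i) (x (i + 1)) (hxa i hi) (hx i hi) (hxb i hi)
      exact ⟨τ, fun _ => h'⟩
    · exact ⟨0, fun h' => absurd h' hi⟩
  choose τ hτ using hτ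
  have hp : ∀ i, ∃ p : Polynomial ℝ, i < n → _ := fun i => by
    by_cases hi : i < n
    · obtain ⟨p, h'⟩ := approx a b hab (k + 1) w hwcd (x i) (x (i + 1)) (hxa i hi) (hx i hi).le
        (hxb i hi)
      exact ⟨p, fun _ => h'⟩
    · exact ⟨0, fun h' => absurd h' hi⟩
  choose p hp using hp
  have horth := orthogonality k n a b hab x a2 f σ hx0 hxn hx hxa hxb
    (fun t ht => by have := hode t ht; simp only [zero_mul, add_zero] at this; exact this.symm)
    (by change a2 b * derivWithin u (Icc a b) b = 0; rw [hub, mul_zero])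
    τ (fun i hi => (hτ i hi).1) (fun i hi => (hτ i hi).2.1) (fun i hi => (hτ i hi).2.2.1)
    (fun i hi => (hτ i hi).2.2.2.1) u0 un Du hsol (fun i => Du i - p i)
    (fun i hi => (Polynomial.degree_sub_le _ _).trans
      (max_le (hsol.2.1 i hi).1 (hp i hi).1))
  have hh0 : 0 ≤ h := (sub_nonneg.2 (hx 0 (by omega)).le).trans (hh 0 (by omega))
  have hDw : ContinuousOn (fun t => (iteratedDerivWithin (k + 2) w (Icc a b) t) ^ 2) (Icc a b) :=
    (hwcd.continuousOn_iteratedDerivWithin le_rfl hu).pow 2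
  have hDσ : ContinuousOn (fun t => (iteratedDerivWithin (k + 2) σ (Icc a b) t) ^ 2) (Icc a b) :=
    (hσcd.continuousOn_iteratedDerivWithin le_rfl hu).pow 2
  -- local estimate
  have hloc : ∀ i < n, ∫ t in x i..x (i + 1), ((Du i).eval t - w t) ^ 2 ≤
      4 / amin * ((∫ t in x i..x (i + 1), a2 t * (Du i).eval t * (Du i - p i).eval t)
        - ∫ t in x i..x (i + 1), (τ i).eval t * (Du i - p i).eval t)
      + (K1 * (h ^ (2 * (k + 2)) * ∫ t in x i..x (i + 1),
          (iteratedDerivWithin (k + 2) w (Icc a b) t) ^ 2)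
        + K2 * (h ^ (2 * (k + 2)) * ∫ t in x i..x (i + 1),
          (iteratedDerivWithin (k + 2) σ (Icc a b) t) ^ 2)) := by
    intro i hi
    have hcd := hx i hi
    have hu' : uIcc (x i) (x (i + 1)) = Icc (x i) (x (i + 1)) := uIcc_of_le hcd.le
    have hwc : ContinuousOn w (uIcc (x i) (x (i + 1))) :=
      hwcd.continuousOn.mono (hu' ▸ hsub i hi)
    have hσc : ContinuousOn σ (uIcc (x i) (x (i + 1))) :=
      hσcd.continuousOn.mono (hu' ▸ hsub i hi)
    have hac : ContinuousOn a2 (uIcc (x i) (x (i + 1))) :=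
      ha2.continuousOn.mono (hu' ▸ hsub i hi)
    have i0 : IntervalIntegrable (fun t => ((Du i).eval t - w t) ^ 2) volume (x i) (x (i + 1)) := by
      apply ContinuousOn.intervalIntegrable; fun_prop
    have i1 : IntervalIntegrable (fun t => a2 t * (Du i).eval t * (Du i - p i).eval t)
        volume (x i) (x (i + 1)) := by
      apply ContinuousOn.intervalIntegrable; fun_prop
    have i2 : IntervalIntegrable (fun t => (τ i).eval t * (Du i - p i).eval t)
        volume (x i) (x (i + 1)) := by
      apply ContinuousOn.intervalIntegrable; fun_prop
    have i3 : IntervalIntegrable (fun t => (w t - (p i).eval t) ^ 2) volume (x i) (x (i + 1)) := by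
      apply ContinuousOn.intervalIntegrable; fun_prop
    have i4 : IntervalIntegrable (fun t => (σ t - (τ i).eval t) ^ 2) volume (x i) (x (i + 1)) := by
      apply ContinuousOn.intervalIntegrable; fun_prop
    have hle := intervalIntegral.integral_mono_on hcd.le i0
      ((((i1.sub i2).const_mul (4 / amin)).add (i3.const_mul K1)).add (i4.const_mul K2))
      (fun t ht => by
        have := pointwise_bound amin M (a2 t) ((Du i).eval t) ((p i).eval t) (w t) (σ t)
          ((τ i).eval t) hamin (ha2lb t (hsub i hi ht)) (hM t (hsub i hi ht)) rfl
        simpa only [Polynomial.eval_sub] using this)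
    rw [intervalIntegral.integral_add (((i1.sub i2).const_mul (4 / amin)).add (i3.const_mul K1))
        (i4.const_mul K2),
      intervalIntegral.integral_add ((i1.sub i2).const_mul (4 / amin)) (i3.const_mul K1),
      intervalIntegral.integral_const_mul, intervalIntegral.integral_const_mul,
      intervalIntegral.integral_const_mul, intervalIntegral.integral_sub i1 i2] at hle
    have hpow : (x (i + 1) - x i) ^ (2 * (k + 2)) ≤ h ^ (2 * (k + 2)) :=
      pow_le_pow_left₀ (sub_nonneg.2 hcd.le) (hh i hi) _
    have g1 : ∫ t in x i..x (i + 1), (w t - (p i).eval t) ^ 2 ≤ h ^ (2 * (k + 2)) *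
        ∫ t in x i..x (i + 1), (iteratedDerivWithin (k + 2) w (Icc a b) t) ^ 2 :=
      (hp i hi).2.trans (mul_le_mul_of_nonneg_right hpow
        (intervalIntegral.integral_nonneg hcd.le fun t _ => sq_nonneg _))
    have g2 : ∫ t in x i..x (i + 1), (σ t - (τ i).eval t) ^ 2 ≤ h ^ (2 * (k + 2)) *
        ∫ t in x i..x (i + 1), (iteratedDerivWithin (k + 2) σ (Icc a b) t) ^ 2 :=
      (hτ i hi).2.2.2.2.trans (mul_le_mul_of_nonneg_right hpow
        (intervalIntegral.integral_nonneg hcd.le fun t _ => sq_nonneg _))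
    have g3 := mul_le_mul_of_nonneg_left g1 hK1p.le
    have g4 := mul_le_mul_of_nonneg_left g2 hK2p.le
    linarith
  have hadj : ∀ F : ℝ → ℝ, ContinuousOn F (Icc a b) →
      ∑ i ∈ Finset.range n, ∫ t in x i..x (i + 1), F t = ∫ t in a..b, F t := by
    intro F hF
    rw [intervalIntegral.sum_integral_adjacent_intervals, hx0, hxn]
    intro i hi
    apply ContinuousOn.intervalIntegrable
    rw [uIcc_of_le (hx i hi).le]
    exact hF.mono (hsub i hi)
  have hsum := Finset.sum_le_sum fun i hi => hloc i (Finset.mem_range.1 hi)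
  rw [Finset.sum_add_distrib, ← Finset.mul_sum, Finset.sum_sub_distrib, horth, sub_self, mul_zero,
    zero_add, Finset.sum_add_distrib, ← Finset.mul_sum, ← Finset.mul_sum, ← Finset.mul_sum,
    ← Finset.mul_sum, hadj _ hDw, hadj _ hDσ] at hsum
  -- global estimate
  have hDj : ∀ j ∈ Finset.range (k + 2 + 1), IntervalIntegrable
      (fun t => (iteratedDerivWithin j w (Icc a b) t) ^ 2) volume a b := by
    intro j hj
    apply ContinuousOn.intervalIntegrable
    rw [uIcc_of_le hab.le]
    have : j ≤ k + 2 := Nat.lt_succ_iff.1 (Finset.mem_range.1 hj)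
    exact (hwcd.continuousOn_iteratedDerivWithin (by exact_mod_cast this) hu).pow 2
  set S := ∑ j ∈ Finset.range (k + 3 + 1),
    ∫ t in a..b, (iteratedDerivWithin j u (Set.Icc a b) t) ^ 2 with hS
  have hnn : ∀ g : ℝ → ℝ, 0 ≤ ∫ t in a..b, (g t) ^ 2 := fun g =>
    intervalIntegral.integral_nonneg hab.le fun t _ => sq_nonneg _
  have hS' : ∑ j ∈ Finset.range (k + 2 + 1),
      ∫ t in a..b, (iteratedDerivWithin j w (Set.Icc a b) t) ^ 2 ≤ S := by
    rw [hS, Finset.sum_range_succ' _ (k + 3)]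
    simp only [iteratedDerivWithin_succ']
    have := hnn (iteratedDerivWithin 0 u (Icc a b))
    linarith
  have hE1 : ∫ t in a..b, (iteratedDerivWithin (k + 2) w (Icc a b) t) ^ 2 ≤ S :=
    le_trans (Finset.single_le_sum
      (f := fun j => ∫ t in a..b, (iteratedDerivWithin j w (Set.Icc a b) t) ^ 2)
      (fun j _ => hnn _) (Finset.self_mem_range_succ (k + 2))) hS'
  have hE2 : ∫ t in a..b, (iteratedDerivWithin (k + 2) σ (Icc a b) t) ^ 2 ≤ K * S := by
    refine le_trans ?_ (mul_le_mul_of_nonneg_left hS' hK0)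
    rw [← intervalIntegral.integral_finsetSum hDj, ← intervalIntegral.integral_const_mul]
    refine intervalIntegral.integral_mono_on hab.le ?_ ?_ fun t ht => hK w hwcd t ht
    · apply ContinuousOn.intervalIntegrable
      rwa [uIcc_of_le hab.le]
    · apply ContinuousOn.intervalIntegrable
      rw [uIcc_of_le hab.le]
      refine continuousOn_const.mul (continuousOn_finsetSum _ fun j hj => ?_)
      have : j ≤ k + 2 := Nat.lt_succ_iff.1 (Finset.mem_range.1 hj)
      exact (hwcd.continuousOn_iteratedDerivWithin (by exact_mod_cast this) hu).pow 2
  have hfin : ∑ i ∈ Finset.range n, ∫ t in x i..x (i + 1), ((Du i).eval t - w t) ^ 2 ≤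
      (K1 + K2 * K) * (h ^ (k + 2)) ^ 2 * S := by
    have hhp : 0 ≤ h ^ (2 * (k + 2)) := by positivity
    have t1 := mul_le_mul_of_nonneg_left (mul_le_mul_of_nonneg_left hE1 hhp) hK1p.le
    have t2 := mul_le_mul_of_nonneg_left (mul_le_mul_of_nonneg_left hE2 hhp) hK2p.le
    have : (h ^ (k + 2)) ^ 2 = h ^ (2 * (k + 2)) := by rw [← pow_mul, mul_comm]
    rw [this]
    linarith
  refine (Real.sqrt_le_sqrt hfin).trans (le_of_eq ?_)
  rw [sobNorm, ← hS, Real.sqrt_mul (by positivity), Real.sqrt_mul (by positivity),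
    Real.sqrt_sq (by positivity)]
end
end
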